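/- arXiv:1504.01243 — 8 statements merged into one kernel-verified Lean document; each statement's English description precedes it below -/
import Mathlib

section
/- Let n be a natural number, let a : Fin n → ℂ and E : Fin n → ℝ, and let Δ₀ > 0 be a real number such that E j ≥ Δ₀ for every j. Define f : ℂ → ℂ by f(z) = Σ_j a_j · exp(i·E_j·z). Then for all real numbers s, T with 0 < 2s < T one has |(1/(2π)) · ∫₀^π f(T·e^{iθ}) · (T·e^{iθ}/(T·e^{iθ} − i·s)) dθ| ≤ (Σ_j |a_j|) · (1 − exp(−T·Δ₀)) / (2·Δ₀·T·√(1 − 2s/T)). -/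
open Real Complex intervalIntegral

/-- Jordan's inequality integrated over a quarter circle. -/
theorem integral_exp_neg_mul_sin_quarter_le {c : ℝ} (hc : 0 < c) :
    ∫ θ in (0:ℝ)..(π / 2), Real.exp (-(c * Real.sin θ)) ≤
      π / (2 * c) * (1 - Real.exp (-c)) := by
  have hπ : (0:ℝ) < π := Real.pi_pos
  calc ∫ θ in (0:ℝ)..(π / 2), Real.exp (-(c * Real.sin θ))
      ≤ ∫ θ in (0:ℝ)..(π / 2), Real.exp (-(c * (2 / π * θ))) := by
        refine integral_mono_on (by positivity)
          (Continuous.intervalIntegrable (by fun_prop) _ _)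
          (Continuous.intervalIntegrable (by fun_prop) _ _) fun θ hθ ↦ ?_
        have := Real.mul_le_sin hθ.1 hθ.2
        gcongr
    _ = π / (2 * c) * (1 - Real.exp (-c)) := by
        have hderiv : ∀ θ : ℝ, HasDerivAt
            (fun θ : ℝ ↦ -(π / (2 * c)) * Real.exp (-(c * (2 / π * θ))))
            (Real.exp (-(c * (2 / π * θ)))) θ := fun θ ↦ by
          have h := ((((hasDerivAt_id θ).const_mul (2 / π)).const_mul c).neg.exp).const_mul
            (-(π / (2 * c)))
          refine h.congr_deriv ?_
          simp only [id_eq, Pi.neg_apply]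
          field_simp
        rw [integral_eq_sub_of_hasDerivAt (fun θ _ ↦ hderiv θ)
          (Continuous.intervalIntegrable (by fun_prop) _ _)]
        have h : c * (2 / π * (π / 2)) = c := by field_simp
        simp only [h, mul_zero, neg_zero, Real.exp_zero]
        ring

/-- The integral estimate behind Jordan's lemma. -/
theorem integral_exp_neg_mul_sin_le {c : ℝ} (hc : 0 < c) :
    ∫ θ in (0:ℝ)..π, Real.exp (-(c * Real.sin θ)) ≤ π / c * (1 - Real.exp (-c)) := by
  have hint : ∀ u v : ℝ, IntervalIntegrable (fun θ ↦ Real.exp (-(c * Real.sin θ)))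
      MeasureTheory.volume u v :=
    fun u v ↦ Continuous.intervalIntegrable (by fun_prop) _ _
  have hsymm : ∫ θ in (π / 2)..π, Real.exp (-(c * Real.sin θ)) =
      ∫ θ in (0:ℝ)..(π / 2), Real.exp (-(c * Real.sin θ)) := by
    have h := integral_comp_sub_left (a := 0) (b := π / 2)
      (fun θ ↦ Real.exp (-(c * Real.sin θ))) π
    simp only [Real.sin_pi_sub, sub_zero, sub_half] at h
    exact h.symm
  rw [← integral_add_adjacent_intervals (hint 0 (π / 2)) (hint (π / 2) π), hsymm]
  have h := integral_exp_neg_mul_sin_quarter_le hc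
  have hsplit : π / c * (1 - Real.exp (-c)) =
      π / (2 * c) * (1 - Real.exp (-c)) + π / (2 * c) * (1 - Real.exp (-c)) := by
    field_simp
    ring
  linarith

theorem norm_sum_mul_exp_semicircle_le {ι : Type*} [Fintype ι] (a : ι → ℂ) (E : ι → ℝ)
    {Δ T θ : ℝ} (hE : ∀ j, Δ ≤ E j) (hT : 0 ≤ T) (hθ : 0 ≤ Real.sin θ) :
    ‖∑ j, a j * Complex.exp (Complex.I * (E j) * (T * Complex.exp (Complex.I * θ)))‖ ≤
      (∑ j, ‖a j‖) * Real.exp (-(T * Δ * Real.sin θ)) := by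
  rw [Finset.sum_mul]
  refine (norm_sum_le _ _).trans (Finset.sum_le_sum fun j _ ↦ ?_)
  rw [norm_mul, Complex.norm_exp, mul_comm Complex.I (θ : ℂ), Complex.exp_mul_I,
    ← Complex.ofReal_cos, ← Complex.ofReal_sin]
  gcongr
  have h := mul_le_mul_of_nonneg_left (hE j) (mul_nonneg hT hθ)
  simp [-Complex.ofReal_sin, -Complex.ofReal_cos]
  linarith

theorem norm_mul_sqrt_le_norm_semicircle_sub {s T : ℝ} (θ : ℝ) (hs : 0 ≤ s) (hT : 0 < T) :
    T * Real.sqrt (1 - 2 * s / T) ≤ ‖T * Complex.exp (Complex.I * θ) - Complex.I * s‖ := by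
  have hsq : T * Real.sqrt (1 - 2 * s / T) = Real.sqrt (T ^ 2 * (1 - 2 * s / T)) := by
    rw [Real.sqrt_mul (by positivity), Real.sqrt_sq hT.le]
  rw [hsq, mul_comm Complex.I (θ : ℂ), Complex.exp_mul_I, ← Complex.ofReal_cos,
    ← Complex.ofReal_sin]
  refine Real.sqrt_le_iff.2 ⟨norm_nonneg _, ?_⟩
  rw [Complex.sq_norm, Complex.normSq_apply]
  have h : T ^ 2 * (1 - 2 * s / T) = T ^ 2 - 2 * s * T := by field_simp
  have h1 := mul_le_mul_of_nonneg_left (Real.sin_le_one θ) (mul_nonneg hs hT.le)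
  have h2 : T ^ 2 * (Real.sin θ ^ 2 + Real.cos θ ^ 2) = T ^ 2 := by
    rw [Real.sin_sq_add_cos_sq, mul_one]
  rw [h]
  simp [-Complex.ofReal_sin, -Complex.ofReal_cos]
  nlinarith [sq_nonneg s]

theorem norm_semicircle_div_sub_le {s T : ℝ} (θ : ℝ) (hs : 0 ≤ s) (hsT : 2 * s < T) :
    ‖(T * Complex.exp (Complex.I * θ)) / (T * Complex.exp (Complex.I * θ) - Complex.I * s)‖ ≤
      1 / Real.sqrt (1 - 2 * s / T) := by
  have hT : 0 < T := by linarith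
  have hpos : 0 < 1 - 2 * s / T := sub_pos.2 ((div_lt_one hT).2 hsT)
  have hr : 0 < Real.sqrt (1 - 2 * s / T) := Real.sqrt_pos.2 hpos
  have h := norm_mul_sqrt_le_norm_semicircle_sub θ hs hT
  have hnum : ‖(T : ℂ) * Complex.exp (Complex.I * θ)‖ = T := by
    rw [norm_mul, mul_comm Complex.I, Complex.norm_exp_ofReal_mul_I, Complex.norm_real,
      Real.norm_of_nonneg hT.le, mul_one]
  rw [norm_div, hnum, div_le_div_iff₀ ((mul_pos hT hr).trans_le h) hr, one_mul]
  exact h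


open Real Complex intervalIntegral

/-- Bound on the semicircle contour integral of `f(z)/(z - is)` for
`f(z) = Σ_j a_j exp(i E_j z)` with all `E_j ≥ Δ₀ > 0` and `0 < 2s < T`. -/
theorem abs_semicircle_integral_le
    (n : ℕ) (a : Fin n → ℂ) (E : Fin n → ℝ) (Δ₀ : ℝ) (hΔ₀ : 0 < Δ₀)
    (hE : ∀ j, Δ₀ ≤ E j)
    (f : ℂ → ℂ) (hf : ∀ z : ℂ, f z = ∑ j, a j * Complex.exp (Complex.I * (E j) * z))
    (s T : ℝ) (hs : 0 < s) (hsT : 2 * s < T) :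
    ‖(1 / (2 * (π : ℂ))) *
        ∫ θ in (0:ℝ)..π,
          f (T * Complex.exp (Complex.I * θ)) *
            ((T * Complex.exp (Complex.I * θ)) /
              (T * Complex.exp (Complex.I * θ) - Complex.I * s))‖
      ≤ (∑ j, ‖a j‖) * (1 - Real.exp (-(T * Δ₀))) /
          (2 * Δ₀ * T * Real.sqrt (1 - 2 * s / T)) := by
  have hT : 0 < T := by linarith
  set r := Real.sqrt (1 - 2 * s / T)
  have hr0 : 0 < r := Real.sqrt_pos.2 (sub_pos.2 ((div_lt_one hT).2 hsT))
  have hπ : (0:ℝ) < π := Real.pi_pos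
  have hbound : ‖∫ θ in (0:ℝ)..π,
      f (T * Complex.exp (Complex.I * θ)) *
        ((T * Complex.exp (Complex.I * θ)) /
          (T * Complex.exp (Complex.I * θ) - Complex.I * s))‖ ≤
      ∫ θ in (0:ℝ)..π, (∑ j, ‖a j‖) * (1 / r) * Real.exp (-(T * Δ₀ * Real.sin θ)) := by
    refine norm_integral_le_of_norm_le hπ.le (.of_forall fun θ hθ ↦ ?_)
      (Continuous.intervalIntegrable (by fun_prop) _ _)
    rw [norm_mul, hf, mul_right_comm]
    exact mul_le_mul
      (norm_sum_mul_exp_semicircle_le a E hE hT.le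
        (Real.sin_nonneg_of_nonneg_of_le_pi hθ.1.le hθ.2))
      (norm_semicircle_div_sub_le θ hs.le hsT) (norm_nonneg _) (by positivity)
  rw [integral_const_mul] at hbound
  have hnorm : ‖(1 / (2 * (π : ℂ)))‖ = 1 / (2 * π) := by
    simp [abs_of_pos hπ]
  rw [norm_mul, hnorm]
  calc _ ≤ 1 / (2 * π) * ((∑ j, ‖a j‖) * (1 / r) *
        (π / (T * Δ₀) * (1 - Real.exp (-(T * Δ₀))))) := by
        gcongr
        refine hbound.trans ?_
        gcongr
        exact integral_exp_neg_mul_sin_le (mul_pos hT hΔ₀)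
    _ = _ := by
        field_simp
end

section
/- Let N ≥ 1 and let P : ℝ × ℝ → M_N(ℂ) be a smooth (infinitely differentiable) family of N×N complex matrices such that for every φ ∈ ℝ², P(φ) is Hermitian and P(φ)·P(φ) = P(φ), and such that P is 2π-periodic in each variable, i.e. P(φ₁ + 2π, φ₂) = P(φ₁, φ₂) = P(φ₁, φ₂ + 2π) for all (φ₁, φ₂). Then there exists an integer p such that i · ∫₀^{2π} ∫₀^{2π} Tr( P(φ) · ( ∂₁P(φ)·∂₂P(φ) − ∂₂P(φ)·∂₁P(φ) ) ) dφ₂ dφ₁ = 2πp. -/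
open Real Matrix intervalIntegral

attribute [local instance] Matrix.normedAddCommGroup Matrix.normedSpace

/-- A Hermitian idempotent factors through an orthonormal frame of its range. -/
theorem exists_frame {n : Type*} [Fintype n] [DecidableEq n] {Q : Matrix n n ℂ}
    (hQ : Q.IsHermitian) (hQ2 : Q * Q = Q) :
    ∃ (r : ℕ) (V : Matrix n (Fin r) ℂ), V * Vᴴ = Q ∧ Vᴴ * V = 1 := by
  classical
  have hU : (hQ.eigenvectorUnitary : Matrix n n ℂ)ᴴ * hQ.eigenvectorUnitary = 1 :=
    Matrix.mem_unitaryGroup_iff'.1 hQ.eigenvectorUnitary.2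
  have hU' : (hQ.eigenvectorUnitary : Matrix n n ℂ) * (hQ.eigenvectorUnitary : Matrix n n ℂ)ᴴ = 1 :=
    Matrix.mem_unitaryGroup_iff.1 hQ.eigenvectorUnitary.2
  have hspec := hQ.spectral_theorem
  rw [Unitary.conjStarAlgAut_apply] at hspec
  change Q = (hQ.eigenvectorUnitary : Matrix n n ℂ) * _ * (hQ.eigenvectorUnitary : Matrix n n ℂ)ᴴ
    at hspec
  set U : Matrix n n ℂ := (hQ.eigenvectorUnitary : Matrix n n ℂ)
  set D : Matrix n n ℂ := diagonal (RCLike.ofReal ∘ hQ.eigenvalues) with hD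
  have hDD : D * D = D := by
    have h1 : D = Uᴴ * Q * U := by
      rw [hspec]
      calc D = (Uᴴ * U) * D * (Uᴴ * U) := by simp [hU]
        _ = _ := by simp only [Matrix.mul_assoc]
    calc D * D = Uᴴ * Q * (U * Uᴴ) * Q * U := by rw [h1]; simp only [Matrix.mul_assoc]
      _ = Uᴴ * (Q * Q) * U := by rw [hU']; simp only [Matrix.mul_assoc, Matrix.mul_one]
      _ = D := by rw [hQ2, h1]
  have hev : ∀ i, hQ.eigenvalues i = 0 ∨ hQ.eigenvalues i = 1 := by
    intro i
    have h1 := congrFun (congrFun hDD i) i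
    simp only [hD, diagonal_mul_diagonal, diagonal_apply_eq, Function.comp] at h1
    have h2 : hQ.eigenvalues i * hQ.eigenvalues i = hQ.eigenvalues i := by
      exact_mod_cast h1
    have h3 : hQ.eigenvalues i * (hQ.eigenvalues i - 1) = 0 := by linarith
    rcases mul_eq_zero.1 h3 with h | h
    · exact Or.inl h
    · exact Or.inr (by linarith)
  let e := (Fintype.equivFin {i // hQ.eigenvalues i = 1}).symm
  refine ⟨_, U.submatrix id (fun k => (e k : n)), ?_, ?_⟩
  · refine Eq.trans ?_ hspec.symm
    ext i j
    simp only [Matrix.mul_apply, Matrix.submatrix_apply, Matrix.conjTranspose_apply, id]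
    rw [e.sum_comp (fun k : {i // hQ.eigenvalues i = 1} => U i k * star (U j k)),
      ← Finset.sum_subtype (Finset.univ.filter (fun i => hQ.eigenvalues i = 1)) (by simp)
        (fun k => U i k * star (U j k)), Finset.sum_filter]
    refine Finset.sum_congr rfl fun k _ => ?_
    rcases hev k with h | h <;> simp [h, hD, Matrix.diagonal_apply]
  · ext i j
    have h1 := congrFun (congrFun hU (e i)) (e j)
    simp only [Matrix.mul_apply, Matrix.submatrix_apply, Matrix.conjTranspose_apply, id] at h1 ⊢
    rw [h1, Matrix.one_apply, Matrix.one_apply]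
    simp [Subtype.ext_iff.symm]

/-- The derivative of `Y ↦ log det (1 + Y)` at `0` is the trace. -/
theorem hasFDerivAt_log_det_one_add {n : Type*} [Fintype n] [DecidableEq n] :
    HasFDerivAt (𝕜 := ℂ) (fun Y : Matrix n n ℂ => Complex.log (1 + Y).det)
      (LinearMap.toContinuousLinearMap (Matrix.traceLinearMap n ℂ ℂ)) 0 := by
  have hd : DifferentiableAt ℂ (fun Y : Matrix n n ℂ => Complex.log (1 + Y).det) 0 := by
    refine DifferentiableAt.clog ?_ (by simp)
    simp only [Matrix.det_apply]
    have : ∀ i j, Differentiable ℂ (fun Y : Matrix n n ℂ => Y i j) := fun i j =>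
      (LinearMap.toContinuousLinearMap (Matrix.entryLinearMap ℂ ℂ i j)).differentiable
    simp only [Matrix.add_apply]
    fun_prop
  have := hd.hasFDerivAt
  convert this using 1
  ext M
  have h1 : HasDerivAt (fun t : ℂ => t • M) M 0 := by
    exact ((hasDerivAt_id (0 : ℂ)).smul_const M).congr_deriv (one_smul ℂ M)
  have h2 := HasFDerivAt.comp_hasDerivAt_of_eq (0:ℂ) this h1 (by simp)
  have h3 : HasDerivAt (fun t : ℂ => Complex.log (1 + t • M).det) (trace M) 0 := by
    have h4 : HasDerivAt (fun t : ℂ => (1 + t • M).det) (trace M) 0 := by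
      have h5 := Polynomial.hasDerivAt (det (1 + (Polynomial.X : Polynomial ℂ) • M.map Polynomial.C)) 0
      rw [derivative_det_one_add_X_smul] at h5
      refine h5.congr_of_eventuallyEq (Filter.Eventually.of_forall fun t => ?_)
      dsimp only
      rw [← Polynomial.coe_evalRingHom, RingHom.map_det]
      congr 1
      ext i j
      simp [Matrix.one_apply, apply_ite]
      exact mul_comm _ _
    simpa using h4.clog (by simp)
  exact h3.unique h2

/-- The phases of the plaquette variables of a lattice gauge field on a discrete torus add up to
a multiple of `2π`, because every link is traversed once in each direction. -/
theorem sum_im_log_plaquette (n : ℕ) (L₁ L₂ : ℕ → ℕ → ℂ)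
    (h₁ : ∀ j, L₁ j n = L₁ j 0) (h₂ : ∀ k, L₂ n k = L₂ 0 k)
    (W : ℕ → ℕ → ℂ)
    (hW : ∀ j k, W j k = L₁ j k * L₂ (j + 1) k * star (L₁ j (k + 1)) * star (L₂ j k))
    (hW0 : ∀ j < n, ∀ k < n, W j k ≠ 0) :
    ∃ m : ℤ, ∑ j ∈ Finset.range n, ∑ k ∈ Finset.range n, (Complex.log (W j k)).im = 2 * π * m := by
  have shift : ∀ f : ℕ → ℂ, f n = f 0 → (∀ k < n, f k ≠ 0) →
      ∏ k ∈ Finset.range n, f (k + 1) = ∏ k ∈ Finset.range n, f k := by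
    intro f hf hf0
    rcases Nat.eq_zero_or_pos n with rfl | hn
    · simp
    · have := (Finset.prod_range_succ' f n).symm.trans (Finset.prod_range_succ f n)
      rw [hf] at this
      exact mul_right_cancel₀ (hf0 0 hn) this
  have hL₁ : ∀ j < n, ∀ k < n, L₁ j k ≠ 0 := fun j hj k hk h => hW0 j hj k hk (by simp [hW, h])
  have hL₂ : ∀ j < n, ∀ k < n, L₂ j k ≠ 0 := fun j hj k hk h => hW0 j hj k hk (by simp [hW, h])
  set R : ℝ := ∏ j ∈ Finset.range n, ∏ k ∈ Finset.range n, ‖L₁ j k‖ ^ 2 * ‖L₂ j k‖ ^ 2 with hR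
  have hRpos : 0 < R := by
    refine Finset.prod_pos fun j hj => Finset.prod_pos fun k hk => ?_
    have := norm_pos_iff.2 (hL₁ j (Finset.mem_range.1 hj) k (Finset.mem_range.1 hk))
    have := norm_pos_iff.2 (hL₂ j (Finset.mem_range.1 hj) k (Finset.mem_range.1 hk))
    positivity
  have hprod : ∏ j ∈ Finset.range n, ∏ k ∈ Finset.range n, W j k = (R : ℂ) := by
    have e1 : ∏ j ∈ Finset.range n, ∏ k ∈ Finset.range n, star (L₁ j (k + 1)) =
        ∏ j ∈ Finset.range n, ∏ k ∈ Finset.range n, star (L₁ j k) :=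
      Finset.prod_congr rfl fun j hj => shift (fun k => star (L₁ j k)) (by simp [h₁])
        fun k hk => star_ne_zero.2 (hL₁ j (Finset.mem_range.1 hj) k hk)
    have e2 : ∏ j ∈ Finset.range n, ∏ k ∈ Finset.range n, L₂ (j + 1) k =
        ∏ j ∈ Finset.range n, ∏ k ∈ Finset.range n, L₂ j k := by
      rw [Finset.prod_comm, Finset.prod_comm (f := fun j k => L₂ j k)]
      exact Finset.prod_congr rfl fun k hk => shift (fun j => L₂ j k) (h₂ k)
        fun j hj => hL₂ j hj k (Finset.mem_range.1 hk)
    simp only [hW, Finset.prod_mul_distrib, e1, e2]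
    simp only [hR, Complex.ofReal_prod, ← Finset.prod_mul_distrib]
    refine Finset.prod_congr rfl fun j _ => Finset.prod_congr rfl fun k _ => ?_
    push_cast
    rw [← Complex.mul_conj', ← Complex.mul_conj']
    simp only [Complex.star_def]
    ring
  have hexp : Complex.exp (∑ j ∈ Finset.range n, ∑ k ∈ Finset.range n, Complex.log (W j k)) =
      Complex.exp (Real.log R : ℝ) := by
    rw [← Complex.ofReal_exp, Real.exp_log hRpos, ← hprod, Complex.exp_sum]
    refine Finset.prod_congr rfl fun j hj => ?_
    rw [Complex.exp_sum]
    exact Finset.prod_congr rfl fun k hk =>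
      Complex.exp_log (hW0 j (Finset.mem_range.1 hj) k (Finset.mem_range.1 hk))
  obtain ⟨m, hm⟩ := Complex.exp_eq_exp_iff_exists_int.1 hexp
  refine ⟨m, ?_⟩
  have := congrArg Complex.im hm
  simp only [Complex.im_sum] at this
  rw [this]
  simp
  ring

/-- The difference quotient of a `C¹` function extends continuously to zero step size. -/
theorem exists_difference_quotient {E F : Type*} [NormedAddCommGroup E] [NormedSpace ℝ E]
    [NormedAddCommGroup F] [NormedSpace ℝ F] [CompleteSpace F] {f : E → F} (hf : ContDiff ℝ 1 f) (v : E) :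
    ∃ g : E × ℝ → F, Continuous g ∧ (∀ x, g (x, 0) = fderiv ℝ f x v) ∧
      ∀ x h, f (x + h • v) = f x + h • g (x, h) := by
  have hcont : Continuous (fderiv ℝ f) := hf.continuous_fderiv one_ne_zero
  refine ⟨fun p => ∫ s in (0 : ℝ)..1, fderiv ℝ f (p.1 + (s * p.2) • v) v, ?_, ?_, ?_⟩
  · refine intervalIntegral.continuous_parametric_intervalIntegral_of_continuous' ?_ _ _
    exact (hcont.comp (by fun_prop)).clm_apply continuous_const
  · intro x
    simp
  · intro x h
    have hderiv : ∀ s ∈ Set.uIcc (0 : ℝ) 1, HasDerivAt (fun s : ℝ => f (x + (s * h) • v))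
        (h • fderiv ℝ f (x + (s * h) • v) v) s := by
      intro s _
      have h1 : HasDerivAt (fun s : ℝ => x + (s * h) • v) (h • v) s := by
        simpa using ((hasDerivAt_id s).mul_const h).smul_const v |>.const_add x
      have h2 := ((hf.differentiable one_ne_zero) (x + (s * h) • v)).hasFDerivAt.comp_hasDerivAt s h1
      exact h2.congr_deriv (map_smul _ h v)
    have hint := intervalIntegral.integral_eq_sub_of_hasDerivAt hderiv
      (Continuous.intervalIntegrable
        (((hcont.comp (by fun_prop)).clm_apply continuous_const).const_smul h) _ _)
    rw [intervalIntegral.integral_smul] at hint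
    rw [hint]
    simp

theorem mul_sub_one_mul_of_idempotent {R : Type*} [Ring R] {p x y z : R} (hp : p * p = p)
    (hx : (p + x) * (p + x) = p + x) (hy : (p + y) * (p + y) = p + y)
    (hz : (p + z) * (p + z) = p + z) :
    p * ((p + x) * (p + y) * (p + z) - 1) * p =
      p * (x * y + x * p * z + y * z - x * x - y * y - z * z + x * y * z) * p := by
  have hpp : ∀ u, p * (p * u) = p * u := fun u => by rw [← mul_assoc, hp]
  have key : ∀ u, (p + u) * (p + u) = p + u → p * (u * p) = -(p * (u * (u * p))) := by
    intro u hu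
    have h1 : p * ((p + u) * (p + u)) * p = p * (p + u) * p := by rw [hu]
    simp only [mul_add, add_mul, mul_assoc, hpp, hp] at h1
    have h2 : p * (u * p) + p * (u * (u * p)) = 0 := by
      have := sub_eq_zero.2 h1
      rw [← this]
      abel
    exact eq_neg_of_add_eq_zero_left h2
  simp only [mul_add, add_mul, mul_sub, sub_mul, mul_assoc, hpp, hp, one_mul, key x hx, key y hy,
    key z hz, mul_neg, neg_mul]
  abel

theorem im_trace_mul_I {n : Type*} [Fintype n] {p a b : Matrix n n ℂ}
    (hp : p.IsHermitian) (hp2 : p * p = p) (ha : a.IsHermitian) (hb : b.IsHermitian) :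
    ((trace (p * (a * (a + b) + a * p * b + (a + b) * b - a * a - (a + b) * (a + b) - b * b)
      * p)).im : ℂ) * Complex.I = trace (p * (a * b - b * a)) := by
  have hpp : ∀ u, p * (p * u) = p * u := fun u => by rw [← mul_assoc, hp2]
  have hcyc : ∀ u, trace (p * (u * p)) = trace (p * u) := fun u => by
    rw [← mul_assoc, trace_mul_comm, hpp]
  have hcyc₂ : ∀ u v, trace (p * (u * (v * p))) = trace (p * (u * v)) := fun u v => by
    rw [← hcyc (u * v), mul_assoc]
  have hcyc₄ : ∀ u v w, trace (p * (u * (v * (w * p)))) = trace (p * (u * (v * w))) :=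
    fun u v w => by rw [← hcyc₂ u (v * w), mul_assoc]
  have hm : ∀ z : ℂ, (z.im : ℂ) * Complex.I = (z - star z) / 2 := fun z => by
    apply Complex.ext <;> simp
  have h1 : trace (p * (b * (p * a))) = trace (p * (a * (p * b))) := by
    rw [← mul_assoc, trace_mul_comm, mul_assoc]
  rw [hm, ← trace_conjTranspose]
  simp only [mul_add, add_mul, mul_sub, sub_mul, conjTranspose_add, conjTranspose_sub,
    conjTranspose_mul, hp.eq, ha.eq, hb.eq, trace_add, trace_sub, mul_assoc, hcyc₂, hcyc₄, h1]
  ring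

theorem det_one_add_frame_product {n : Type*} [Fintype n] [DecidableEq n] {r : ℕ}
    (V₁ V₂ V₃ V₄ : Matrix n (Fin r) ℂ)
    (h₁ : V₁ᴴ * V₁ = 1) :
    (1 + V₁ * V₁ᴴ * (V₂ * V₂ᴴ * (V₃ * V₃ᴴ) * (V₄ * V₄ᴴ) - 1) * (V₁ * V₁ᴴ)).det =
      (V₁ᴴ * V₂).det * (V₂ᴴ * V₃).det * star (V₄ᴴ * V₃).det * star (V₁ᴴ * V₄).det := by
  rw [← det_conjTranspose, ← det_conjTranspose, ← det_mul, ← det_mul, ← det_mul,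
    Matrix.mul_assoc V₁, Matrix.mul_assoc V₁, det_one_add_mul_comm]
  congr 1
  simp only [Matrix.mul_sub, Matrix.sub_mul, Matrix.mul_assoc, h₁, Matrix.mul_one,
    conjTranspose_mul, conjTranspose_conjTranspose]
  abel

/-- Uniformly on compact sets, the phase of `det (1 + h² w(x, h))` is `h² Im Tr w(x, 0) + o(h²)`. -/
theorem exists_im_log_det_approx {n : Type*} [Fintype n] [DecidableEq n] {α : Type*} [PseudoMetricSpace α]
    {K : Set α} (hK : IsCompact K) {w : α × ℝ → Matrix n n ℂ} (hw : Continuous w)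
    {ε : ℝ} (hε : 0 < ε) :
    ∃ δ > 0, ∀ x ∈ K, ∀ h : ℝ, 0 < h → h < δ → (1 + h ^ 2 • w (x, h)).det ≠ 0 ∧
      |(Complex.log (1 + h ^ 2 • w (x, h)).det).im - h ^ 2 * (trace (w (x, 0))).im| ≤ ε * h ^ 2 := by
  have hcpt : IsCompact (K ×ˢ Set.Icc (0 : ℝ) 1) := hK.prod isCompact_Icc
  obtain ⟨C, hC0, hC⟩ : ∃ C > 0, ∀ p ∈ K ×ˢ Set.Icc (0 : ℝ) 1, ‖w p‖ ≤ C := by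
    obtain ⟨C, hC⟩ := hcpt.exists_bound_of_continuousOn hw.continuousOn
    exact ⟨max C 1, by positivity, fun p hp => (hC p hp).trans (le_max_left _ _)⟩
  have hdet : ∀ᶠ Y : Matrix n n ℂ in nhds 0, (1 + Y).det ≠ 0 := by
    have : ContinuousAt (fun Y : Matrix n n ℂ => (1 + Y).det) 0 := by
      refine Continuous.continuousAt ?_
      fun_prop
    exact this.eventually_ne (by simp)
  have hlog := ((hasFDerivAt_log_det_one_add (n := n)).isLittleO.def
    (c := ε / (2 * C)) (by positivity)).and hdet
  obtain ⟨ρ, hρ, hball⟩ := Metric.eventually_nhds_iff.1 hlog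
  have hunif := hcpt.uniformContinuousOn_of_continuous
    (f := fun p => (trace (w p)).im)
    (Complex.continuous_im.comp hw.matrix_trace).continuousOn
  obtain ⟨η, hη, hun⟩ := Metric.uniformContinuousOn_iff.1 hunif (ε / 2) (by positivity)
  refine ⟨min (min 1 η) (ρ / C), by positivity, fun x hx h h0 hδ => ?_⟩
  have hh1 : h < 1 := hδ.trans_le ((min_le_left _ _).trans (min_le_left _ _))
  have hhη : h < η := hδ.trans_le ((min_le_left _ _).trans (min_le_right _ _))
  have hhρ : h * C < ρ := (lt_div_iff₀ hC0).1 (hδ.trans_le (min_le_right _ _))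
  have hmem : (x, h) ∈ K ×ˢ Set.Icc (0 : ℝ) 1 := ⟨hx, h0.le, hh1.le⟩
  have hmem0 : (x, (0 : ℝ)) ∈ K ×ˢ Set.Icc (0 : ℝ) 1 := ⟨hx, le_rfl, zero_le_one⟩
  have hn : ‖h ^ 2 • w (x, h)‖ ≤ h ^ 2 * C := by
    rw [norm_smul, Real.norm_of_nonneg (by positivity)]
    exact mul_le_mul_of_nonneg_left (hC _ hmem) (by positivity)
  have hd : dist (h ^ 2 • w (x, h)) 0 < ρ := by
    rw [dist_zero_right]
    refine lt_of_le_of_lt (hn.trans ?_) hhρ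
    exact mul_le_mul_of_nonneg_right (by nlinarith) hC0.le
  obtain ⟨hl, hne⟩ := hball hd
  refine ⟨hne, ?_⟩
  have hu := hun _ hmem _ hmem0 (by simpa [Prod.dist_eq, abs_of_pos h0] using ⟨hη, hhη⟩)
  rw [Real.dist_eq] at hu
  simp only [add_zero, det_one, Complex.log_one, sub_zero] at hl
  change ‖_ - trace (h ^ 2 • w (x, h))‖ ≤ _ at hl
  have hl2 : |(Complex.log (1 + h ^ 2 • w (x, h)).det).im - h ^ 2 * (trace (w (x, h))).im| ≤
      ε / 2 * h ^ 2 := by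
    have h1 := (Complex.abs_im_le_norm _).trans hl
    rw [Complex.sub_im, trace_smul, Complex.smul_im, smul_eq_mul] at h1
    refine h1.trans ((mul_le_mul_of_nonneg_left hn (by positivity)).trans_eq ?_)
    field_simp
  have h3 : |h ^ 2 * (trace (w (x, h))).im - h ^ 2 * (trace (w (x, 0))).im| ≤ ε / 2 * h ^ 2 := by
    rw [← mul_sub, abs_mul, abs_of_nonneg (by positivity), mul_comm]
    exact mul_le_mul_of_nonneg_right hu.le (by positivity)
  refine (abs_sub_le _ (h ^ 2 * (trace (w (x, h))).im) _).trans ?_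
  linarith

/-- Riemann sums over a square approximate the iterated integral of a continuous function. -/
theorem exists_riemann_sum_approx {k : ℝ × ℝ → ℝ} (hk : Continuous k) {T ε : ℝ} (hε : 0 < ε) :
    ∃ δ > 0, ∀ (n : ℕ) (h : ℝ), 0 < h → h < δ → n * h = T →
      |(∫ s in (0 : ℝ)..T, ∫ t in (0 : ℝ)..T, k (s, t)) -
        ∑ i ∈ Finset.range n, ∑ j ∈ Finset.range n, h ^ 2 * k (i * h, j * h)| ≤ ε * T ^ 2 := by
  have hcpt : IsCompact (Set.Icc (0 : ℝ) T ×ˢ Set.Icc (0 : ℝ) T) := isCompact_Icc.prod isCompact_Icc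
  obtain ⟨δ, hδ, hun⟩ := Metric.uniformContinuousOn_iff.1
    (hcpt.uniformContinuousOn_of_continuous hk.continuousOn) ε hε
  refine ⟨δ, hδ, fun n h h0 hhδ hn => ?_⟩
  have hsplit : ∀ f : ℝ → ℝ, Continuous f →
      ∫ s in (0 : ℝ)..T, f s = ∑ i ∈ Finset.range n, ∫ s in (i * h)..(i * h + h), f s := by
    intro f hf
    have := intervalIntegral.sum_integral_adjacent_intervals (f := f) (μ := MeasureTheory.volume)
      (a := fun i : ℕ => i * h) (n := n) fun i _ => hf.intervalIntegrable _ _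
    simp only [Nat.cast_zero, zero_mul, hn, Nat.cast_add, Nat.cast_one, add_mul, one_mul] at this
    exact this.symm
  have hinner : ∀ a b : ℝ, Continuous fun s => ∫ t in a..b, k (s, t) := fun a b =>
    intervalIntegral.continuous_parametric_intervalIntegral_of_continuous'
      (f := fun s t => k (s, t)) hk a b
  have hdouble : ∫ s in (0 : ℝ)..T, ∫ t in (0 : ℝ)..T, k (s, t) = ∑ i ∈ Finset.range n,
      ∑ j ∈ Finset.range n, ∫ s in (i * h)..(i * h + h), ∫ t in (j * h)..(j * h + h), k (s, t) := by
    rw [hsplit _ (hinner 0 T)]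
    refine Finset.sum_congr rfl fun i _ => ?_
    rw [← intervalIntegral.integral_finsetSum fun j _ => (hinner _ _).intervalIntegrable _ _]
    exact intervalIntegral.integral_congr fun s _ => hsplit _ (by fun_prop)
  have hcell : ∀ i ∈ Finset.range n, ∀ j ∈ Finset.range n,
      |(∫ s in (i * h)..(i * h + h), ∫ t in (j * h)..(j * h + h), k (s, t)) -
        h ^ 2 * k (i * h, j * h)| ≤ ε * h ^ 2 := by
    intro i hi j hj
    have hmem : ∀ m ∈ Finset.range n, ∀ s ∈ Set.uIoc (m * h) (m * h + h),
        s ∈ Set.Icc 0 T ∧ (m * h) ∈ Set.Icc 0 T ∧ |s - m * h| < δ := by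
      intro m hm s hs
      rw [Set.uIoc_of_le (by linarith)] at hs
      have hm' : ((m : ℝ) + 1) ≤ n := by exact_mod_cast Finset.mem_range.1 hm
      have hmT : m * h + h ≤ T := by rw [← hn]; nlinarith
      have hm0 : 0 ≤ m * h := by positivity
      refine ⟨⟨by linarith [hs.1], by linarith [hs.2]⟩, ⟨hm0, by linarith⟩, ?_⟩
      rw [abs_lt]
      constructor <;> linarith [hs.1, hs.2]
    have hconst : h ^ 2 * k (i * h, j * h) =
        ∫ s in (i * h)..(i * h + h), ∫ t in (j * h)..(j * h + h), k (i * h, j * h) := by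
      simp
      ring
    rw [hconst, ← intervalIntegral.integral_sub ((hinner _ _).intervalIntegrable _ _)
      (continuous_const.intervalIntegrable _ _)]
    have hb := intervalIntegral.norm_integral_le_of_norm_le_const (a := i * h) (b := i * h + h)
      (C := ε * h) (f := fun s => (∫ t in (j * h)..(j * h + h), k (s, t)) -
        ∫ t in (j * h)..(j * h + h), k (i * h, j * h)) ?_
    · rw [Real.norm_eq_abs] at hb
      refine hb.trans_eq ?_
      rw [add_sub_cancel_left, abs_of_pos h0]
      ring
    · intro s hs
      obtain ⟨hs1, hs2, hs3⟩ := hmem i hi s hs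
      rw [← intervalIntegral.integral_sub (Continuous.intervalIntegrable (by fun_prop) _ _)
        (continuous_const.intervalIntegrable _ _)]
      refine (intervalIntegral.norm_integral_le_of_norm_le_const (C := ε) fun t ht => ?_).trans_eq ?_
      · obtain ⟨ht1, ht2, ht3⟩ := hmem j hj t ht
        exact (hun (s, t) ⟨hs1, ht1⟩ (i * h, j * h) ⟨hs2, ht2⟩
          (by rw [Prod.dist_eq]; exact max_lt hs3 ht3)).le
      · rw [add_sub_cancel_left, abs_of_pos h0]
  rw [hdouble, ← Finset.sum_sub_distrib]
  simp only [← Finset.sum_sub_distrib]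
  refine (Finset.abs_sum_le_sum_abs _ _).trans ((Finset.sum_le_sum fun i hi =>
    (Finset.abs_sum_le_sum_abs _ _).trans (Finset.sum_le_sum fun j hj => hcell i hi j hj)).trans_eq ?_)
  simp only [Finset.sum_const, Finset.card_range, nsmul_eq_mul, ← hn]
  ring

/-- The product of projections around a square of side `h` deviates from the identity, on the range
of the base projection, by `h²` times a continuous function whose value at `h = 0` has the
curvature as the imaginary part of its trace. -/
theorem exists_plaquette_expansion {n : Type*} [Fintype n] [DecidableEq n]
    {P : ℝ × ℝ → Matrix n n ℂ} (hP : ContDiff ℝ 1 P) (hherm : ∀ φ, (P φ).IsHermitian)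
    (hidem : ∀ φ, P φ * P φ = P φ) :
    ∃ w : (ℝ × ℝ) × ℝ → Matrix n n ℂ, Continuous w ∧
      (∀ φ : ℝ × ℝ, ∀ h : ℝ, P φ * (P (φ + h • (1, 0)) * P (φ + h • (1, 1)) *
        P (φ + h • (0, 1)) - 1) * P φ = h ^ 2 • w (φ, h)) ∧
      ∀ φ, ((trace (w (φ, 0))).im : ℂ) * Complex.I =
        trace (P φ * (fderiv ℝ P φ (1, 0) * fderiv ℝ P φ (0, 1) -
          fderiv ℝ P φ (0, 1) * fderiv ℝ P φ (1, 0))) := by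
  obtain ⟨x, hxc, hx0, hx⟩ := exists_difference_quotient hP (1, 0)
  obtain ⟨y, hyc, hy0, hy⟩ := exists_difference_quotient hP (1, 1)
  obtain ⟨z, hzc, hz0, hz⟩ := exists_difference_quotient hP (0, 1)
  have hPc : Continuous fun p : (ℝ × ℝ) × ℝ => P p.1 := hP.continuous.comp continuous_fst
  refine ⟨fun p => P p.1 * (x p * y p + x p * P p.1 * z p + y p * z p - x p * x p - y p * y p -
    z p * z p + p.2 • (x p * y p * z p)) * P p.1, by fun_prop, fun φ h => ?_, fun φ => ?_⟩
  · rw [hx, hy, hz, mul_sub_one_mul_of_idempotent (hidem φ)]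
    · simp only [Matrix.mul_add, Matrix.add_mul, Matrix.mul_sub, Matrix.sub_mul, Matrix.mul_smul,
        Matrix.smul_mul]
      module
    · rw [← hx, hidem]
    · rw [← hy, hidem]
    · rw [← hz, hidem]
  · have hD : ∀ v, (fderiv ℝ P φ v).IsHermitian := by
      intro v
      have h1 := ((hP.differentiable one_ne_zero) φ).hasFDerivAt.star
      have h2 : (fun φ => star (P φ)) = P := funext fun φ => hherm φ
      rw [h2] at h1
      exact (DFunLike.congr_fun h1.fderiv v).symm
    have hadd : fderiv ℝ P φ (1, 1) = fderiv ℝ P φ (1, 0) + fderiv ℝ P φ (0, 1) := by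
      rw [← map_add]
      simp
    have hx0' : x (φ, 0) = fderiv ℝ P φ (1, 0) := hx0 φ
    have hy0' : y (φ, 0) = fderiv ℝ P φ (1, 1) := hy0 φ
    have hz0' : z (φ, 0) = fderiv ℝ P φ (0, 1) := hz0 φ
    simp only [hx0', hy0', hz0', hadd, zero_smul, add_zero]
    exact im_trace_mul_I (hherm φ) (hidem φ) (hD _) (hD _)

/-- A continuous family of projections on a connected space has orthonormal frames of constant
rank, which can be chosen to depend on the value of the projection only. -/
theorem exists_frame_family {n α : Type*} [Fintype n] [DecidableEq n] [TopologicalSpace α]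
    [PreconnectedSpace α] {P : α → Matrix n n ℂ} (hP : Continuous P)
    (hherm : ∀ φ, (P φ).IsHermitian) (hidem : ∀ φ, P φ * P φ = P φ) :
    ∃ (r : ℕ) (V : Matrix n n ℂ → Matrix n (Fin r) ℂ),
      ∀ φ, V (P φ) * (V (P φ))ᴴ = P φ ∧ (V (P φ))ᴴ * V (P φ) = 1 := by
  choose r V hV₁ hV₂ using fun φ => exists_frame (hherm φ) (hidem φ)
  have htr : ∀ φ, trace (P φ) = r φ := fun φ => by
    rw [← hV₁, trace_mul_comm, hV₂]
    simp
  have hr : Continuous r := by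
    have h1 : Continuous fun φ => (r φ : ℝ) := by
      have h2 := Complex.continuous_re.comp hP.matrix_trace
      refine h2.congr fun φ => ?_
      simp [htr]
    exact Nat.isClosedEmbedding_coe_real.isInducing.continuous_iff.2 h1
  rcases isEmpty_or_nonempty α with hα | ⟨⟨φ₀⟩⟩
  · exact ⟨0, 0, fun φ => hα.elim φ⟩
  have key : ∀ φ, ∃ V : Matrix n (Fin (r φ₀)) ℂ, V * Vᴴ = P φ ∧ Vᴴ * V = 1 := by
    intro φ
    rw [PreconnectedSpace.constant inferInstance hr (x := φ₀) (y := φ)]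
    exact ⟨V φ, hV₁ φ, hV₂ φ⟩
  have key' : ∀ Q : Matrix n n ℂ, ∃ V : Matrix n (Fin (r φ₀)) ℂ,
      (∃ φ, P φ = Q) → V * Vᴴ = Q ∧ Vᴴ * V = 1 := by
    intro Q
    by_cases hQ : ∃ φ, P φ = Q
    · obtain ⟨φ, rfl⟩ := hQ
      obtain ⟨V, hV⟩ := key φ
      exact ⟨V, fun _ => hV⟩
    · exact ⟨0, fun h => absurd h hQ⟩
  choose V hV using key'
  exact ⟨r φ₀, V, fun φ => hV _ ⟨φ, rfl⟩⟩

theorem eq_two_pi_mul_int_of_approx {x : ℝ}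
    (hx : ∀ ε > 0, ∃ m : ℤ, |x - 2 * π * m| < ε) : ∃ m : ℤ, x = 2 * π * m := by
  have h1 : x / (2 * π) ∈ closure (Set.range ((↑) : ℤ → ℝ)) := by
    refine Metric.mem_closure_iff.2 fun ε hε => ?_
    obtain ⟨m, hm⟩ := hx (2 * π * ε) (by positivity)
    refine ⟨m, ⟨m, rfl⟩, ?_⟩
    rw [Real.dist_eq, show x / (2 * π) - m = (x - 2 * π * m) / (2 * π) by field_simp, abs_div,
      abs_of_pos Real.two_pi_pos, div_lt_iff₀ Real.two_pi_pos]
    linarith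
  rw [Int.isClosedEmbedding_coe_real.isClosed_range.closure_eq] at h1
  obtain ⟨m, hm⟩ := h1
  refine ⟨m, ?_⟩
  rw [hm]
  field_simp

/-- For a smooth doubly `2π`-periodic family `P : ℝ² → M_N(ℂ)` of Hermitian projections,
the quantity `i ∫₀^{2π} ∫₀^{2π} Tr(P (∂₁P ∂₂P − ∂₂P ∂₁P)) dφ₂ dφ₁` is `2π` times an integer. -/
theorem chern_number_is_integer
    (N : ℕ) (hN : 1 ≤ N) (P : ℝ × ℝ → Matrix (Fin N) (Fin N) ℂ)
    (hsmooth : ContDiff ℝ (⊤ : ℕ∞) P)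
    (hherm : ∀ φ : ℝ × ℝ, (P φ).IsHermitian)
    (hidem : ∀ φ : ℝ × ℝ, P φ * P φ = P φ)
    (hper1 : ∀ φ₁ φ₂ : ℝ, P (φ₁ + 2 * π, φ₂) = P (φ₁, φ₂))
    (hper2 : ∀ φ₁ φ₂ : ℝ, P (φ₁, φ₂ + 2 * π) = P (φ₁, φ₂)) :
    ∃ p : ℤ,
      Complex.I * ∫ φ₁ in (0:ℝ)..(2 * π), ∫ φ₂ in (0:ℝ)..(2 * π),
          Matrix.trace (P (φ₁, φ₂) *
            (fderiv ℝ P (φ₁, φ₂) (1, 0) * fderiv ℝ P (φ₁, φ₂) (0, 1)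
              - fderiv ℝ P (φ₁, φ₂) (0, 1) * fderiv ℝ P (φ₁, φ₂) (1, 0)))
        = (2 * π * p : ℝ) := by
  have hP1 : ContDiff ℝ 1 P := hsmooth.of_le (by exact_mod_cast le_top)
  obtain ⟨w, hwc, hw, hw0⟩ := exists_plaquette_expansion hP1 hherm hidem
  obtain ⟨r, V, hV⟩ := exists_frame_family hP1.continuous hherm hidem
  set κ : ℝ × ℝ → ℝ := fun φ => (trace (w (φ, 0))).im with hκ
  have hκc : Continuous κ := by
    have : Continuous fun φ : ℝ × ℝ => w (φ, 0) := by fun_prop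
    exact Complex.continuous_im.comp this.matrix_trace
  suffices h : ∃ m : ℤ, ∫ s in (0 : ℝ)..2 * π, ∫ t in (0 : ℝ)..2 * π, κ (s, t) = 2 * π * m by
    obtain ⟨m, hm⟩ := h
    refine ⟨-m, ?_⟩
    simp only [← hw0, intervalIntegral.integral_mul_const, intervalIntegral.integral_ofReal]
    change Complex.I * (((∫ s in (0 : ℝ)..2 * π, ∫ t in (0 : ℝ)..2 * π, κ (s, t) : ℝ) : ℂ) *
      Complex.I) = _
    rw [hm, mul_left_comm, Complex.I_mul_I]
    push_cast
    ring
  refine eq_two_pi_mul_int_of_approx fun ε hε => ?_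
  have hc : 0 < ε / (3 * (2 * π) ^ 2) := by positivity
  obtain ⟨δ₁, hδ₁, hlog⟩ := exists_im_log_det_approx
    (isCompact_Icc.prod isCompact_Icc : IsCompact (Set.Icc (0 : ℝ) (2 * π) ×ˢ Set.Icc 0 (2 * π)))
    hwc hc
  obtain ⟨δ₂, hδ₂, hsum⟩ := exists_riemann_sum_approx hκc (T := 2 * π) hc
  obtain ⟨n, hn⟩ := exists_nat_gt (2 * π / min δ₁ δ₂)
  have hδ : 0 < min δ₁ δ₂ := lt_min hδ₁ hδ₂
  have hn0 : (0 : ℝ) < n := (div_pos Real.two_pi_pos hδ).trans hn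
  set h : ℝ := 2 * π / n with hh
  have hpos : 0 < h := by positivity
  have hlt : h < min δ₁ δ₂ := by
    rw [hh, div_lt_iff₀ hn0]
    rw [div_lt_iff₀ hδ] at hn
    linarith
  have hnh : n * h = 2 * π := by
    rw [hh]
    field_simp
  let F : ℕ → ℕ → Matrix (Fin N) (Fin r) ℂ := fun j k => V (P (j * h, k * h))
  have hF : ∀ j k, F j k * (F j k)ᴴ = P (j * h, k * h) := fun j k => (hV _).1
  have hFn₁ : ∀ k, F n k = F 0 k := fun k => by
    simp only [F, hnh, Nat.cast_zero, zero_mul]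
    rw [← hper1 0, zero_add]
  have hFn₂ : ∀ j, F j n = F j 0 := fun j => by
    simp only [F, hnh, Nat.cast_zero, zero_mul]
    rw [← hper2 _ 0, zero_add]
  let W : ℕ → ℕ → ℂ := fun j k => (1 + h ^ 2 • w ((j * h, k * h), h)).det
  have hmem : ∀ j ∈ Finset.range n, (j : ℝ) * h ∈ Set.Icc 0 (2 * π) := fun j hj => by
    refine ⟨by positivity, ?_⟩
    rw [← hnh]
    exact mul_le_mul_of_nonneg_right (by exact_mod_cast (Finset.mem_range.1 hj).le) hpos.le
  have hW : ∀ j ∈ Finset.range n, ∀ k ∈ Finset.range n, W j k ≠ 0 ∧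
      |(Complex.log (W j k)).im - h ^ 2 * κ (j * h, k * h)| ≤ ε / (3 * (2 * π) ^ 2) * h ^ 2 :=
    fun j hj k hk => hlog _ ⟨hmem j hj, hmem k hk⟩ h hpos (hlt.trans_le (min_le_left _ _))
  obtain ⟨m, hm⟩ := sum_im_log_plaquette n (fun j k => ((F j k)ᴴ * F (j + 1) k).det)
    (fun j k => ((F j k)ᴴ * F j (k + 1)).det) (fun j => by simp only [hFn₂])
    (fun k => by simp only [hFn₁]) W (fun j k => by
      rw [← det_one_add_frame_product _ _ _ _ (hV _).2, hF, hF, hF, hF]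
      simp only [W, ← hw]
      simp [add_mul])
    fun j hj k hk => (hW j (Finset.mem_range.2 hj) k (Finset.mem_range.2 hk)).1
  refine ⟨m, ?_⟩
  have h1 := hsum n h hpos (hlt.trans_le (min_le_right _ _)) hnh
  have h2 : |∑ j ∈ Finset.range n, ∑ k ∈ Finset.range n, (Complex.log (W j k)).im -
      ∑ j ∈ Finset.range n, ∑ k ∈ Finset.range n, h ^ 2 * κ (j * h, k * h)| ≤
      ε / (3 * (2 * π) ^ 2) * (2 * π) ^ 2 := by
    simp only [← Finset.sum_sub_distrib]
    refine (Finset.abs_sum_le_sum_abs _ _).trans ((Finset.sum_le_sum fun j hj =>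
      (Finset.abs_sum_le_sum_abs _ _).trans (Finset.sum_le_sum fun k hk =>
        (hW j hj k hk).2)).trans_eq ?_)
    simp only [Finset.sum_const, Finset.card_range, nsmul_eq_mul, ← hnh]
    ring
  rw [hm] at h2
  have h3 : ε / (3 * (2 * π) ^ 2) * (2 * π) ^ 2 = ε / 3 := by field_simp
  rw [h3] at h1 h2
  rw [abs_le] at h1 h2
  rw [abs_lt]
  constructor <;> linarith [h1.1, h1.2, h2.1, h2.2]
end

section
/- Let N, q ≥ 1, let U ⊆ ℝ² be open, and let Φ₁, …, Φ_q : U → ℂ^N be continuously differentiable maps that are pointwise orthonormal: ⟨Φ_m(φ), Φ_{m′}(φ)⟩ = δ_{m m′} for all φ ∈ U and all m, m′. Define P(φ) to be the linear operator on ℂ^N given by P(φ)x = Σ_{m=1}^q ⟨Φ_m(φ), x⟩ · Φ_m(φ). Then for every φ ∈ U, Tr( P(φ) ∘ ( ∂₁P(φ) ∘ ∂₂P(φ) − ∂₂P(φ) ∘ ∂₁P(φ) ) ) = Σ_{m=1}^q ( ⟨∂₁Φ_m(φ), ∂₂Φ_m(φ)⟩ − ⟨∂₂Φ_m(φ), ∂₁Φ_m(φ)⟩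 ). -/
open Real

local notation "⟪" x ", " y "⟫" => @inner ℂ _ _ x y

open InnerProductSpace

/-- `x, y ↦ |x⟩⟨y|` is a bounded bilinear map over the reals. -/
lemma isBoundedBilinearMap_real_rankOne {E : Type*} [NormedAddCommGroup E]
    [InnerProductSpace ℂ E] [NormedSpace ℝ E] [IsScalarTower ℝ ℂ E] :
    IsBoundedBilinearMap ℝ (fun p : E × E => rankOne ℂ p.1 p.2) where
  add_left x y z := by simp
  smul_left c x y := by
    ext z
    simp only [rankOne_apply, smul_apply]
    exact smul_comm _ _ _
  add_right x y z := by simp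
  smul_right c x y := by
    ext z
    simp only [rankOne_apply, smul_apply]
    rw [← algebraMap_smul ℂ c y, inner_smul_left, ← algebraMap_smul ℂ c, mul_smul]
    simp
  bound := ⟨1, one_pos, fun x y => by simp⟩

section Projection

variable {ι E : Type*} [Fintype ι] [NormedAddCommGroup E] [InnerProductSpace ℂ E]

/-- The derivative of `∑ m, |e m⟩⟨e m|` when each `e m` has derivative `a m`. -/
noncomputable def projDeriv (e a : ι → E) : E →L[ℂ] E :=
  ∑ m, (rankOne ℂ (e m) (a m) + rankOne ℂ (a m) (e m))

lemma projDeriv_apply (e a : ι → E) (x : E) :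
    projDeriv e a x = ∑ m, (⟪a m, x⟫ • e m + ⟪e m, x⟫ • a m) := by
  simp [projDeriv]

lemma inner_projDeriv_left (e a : ι → E) (x y : E) :
    ⟪projDeriv e a x, y⟫ = ⟪x, projDeriv e a y⟫ := by
  simp only [projDeriv_apply, sum_inner, inner_sum, inner_add_left, inner_add_right,
    inner_smul_left, inner_smul_right, inner_conj_symm]
  exact Finset.sum_congr rfl fun m _ => by ring

lemma fderiv_sum_rankOne [NormedSpace ℝ E] [IsScalarTower ℝ ℂ E]
    {F : Type*} [NormedAddCommGroup F] [NormedSpace ℝ F] {Φ : ι → F → E} {φ : F}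
    (hΦ : ∀ m, DifferentiableAt ℝ (Φ m) φ) (v : F) :
    fderiv ℝ (fun ψ => ∑ m, rankOne ℂ (Φ m ψ) (Φ m ψ)) φ v
      = projDeriv (fun m => Φ m φ) (fun m => fderiv ℝ (Φ m) φ v) := by
  have key (m : ι) := (isBoundedBilinearMap_real_rankOne.hasFDerivAt (Φ m φ, Φ m φ)).comp φ
    ((hΦ m).hasFDerivAt.prodMk (hΦ m).hasFDerivAt)
  have hsum := HasFDerivAt.fun_sum (u := Finset.univ) fun m _ => key m
  simp only [Function.comp_def] at hsum
  rw [hsum.fderiv, sum_apply]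
  rfl

lemma trace_sum_rankOne_comp [FiniteDimensional ℂ E] (e : ι → E) (T : E →ₗ[ℂ] E) :
    LinearMap.trace ℂ E ((∑ m, rankOne ℂ (e m) (e m)).toLinearMap ∘ₗ T)
      = ∑ m, ⟪e m, T (e m)⟫ := by
  rw [LinearMap.trace_comp_comm']
  have hT : T ∘ₗ (∑ m, rankOne ℂ (e m) (e m)).toLinearMap
      = ∑ m, (rankOne ℂ (T (e m)) (e m)).toLinearMap := by
    ext x
    simp 
  rw [hT, map_sum]
  simp only [trace_rankOne]

variable [DecidableEq ι] {e a b : ι → E}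

lemma projDeriv_apply_self (he : ∀ m k, ⟪e m, e k⟫ = if m = k then (1 : ℂ) else 0) (m : ι) :
    projDeriv e a (e m) = a m + ∑ k, ⟪a k, e m⟫ • e k := by
  simp [projDeriv_apply, Finset.sum_add_distrib, he, add_comm]

lemma sum_inner_projDeriv_comm (he : ∀ m k, ⟪e m, e k⟫ = if m = k then (1 : ℂ) else 0)
    (ha : ∀ m k, ⟪a m, e k⟫ + ⟪e m, a k⟫ = 0) (hb : ∀ m k, ⟪b m, e k⟫ + ⟪e m, b k⟫ = 0) :
    ∑ m, (⟪e m, projDeriv e a (projDeriv e b (e m))⟫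
        - ⟪e m, projDeriv e b (projDeriv e a (e m))⟫)
      = ∑ m, (⟪a m, b m⟫ - ⟪b m, a m⟫) := by
  have key {c d : ι → E} (hc : ∀ m k, ⟪c m, e k⟫ + ⟪e m, c k⟫ = 0)
      (hd : ∀ m k, ⟪d m, e k⟫ + ⟪e m, d k⟫ = 0) (m : ι) :
      ⟪e m, projDeriv e c (projDeriv e d (e m))⟫
        = ⟪c m, d m⟫ + ∑ k, ⟪c m, e k⟫ * ⟪d k, e m⟫ := by
    have hc' (k : ι) : ⟪e m, c k⟫ = -⟪c m, e k⟫ := by linear_combination hc m k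
    have hd' (k : ι) : ⟪e k, d m⟫ = -⟪d k, e m⟫ := by linear_combination hd k m
    rw [← inner_projDeriv_left, projDeriv_apply_self he, projDeriv_apply_self he]
    simp [he, hc', hd', mul_comm]
  simp only [key ha hb, key hb ha, Finset.sum_sub_distrib, Finset.sum_add_distrib]
  have hswap : ∑ m, ∑ k, ⟪a m, e k⟫ * ⟪b k, e m⟫ = ∑ m, ∑ k, ⟪b m, e k⟫ * ⟪a k, e m⟫ := by
    rw [Finset.sum_comm]
    simp only [mul_comm]
  rw [hswap]
  ring

end Projection

/-- For pointwise-orthonormal `C¹` families `Φ₁, …, Φ_q : U → ℂ^N` on an open set `U ⊆ ℝ²`,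
and `P(φ)` the orthogonal projection onto their span,
`Tr(P (∂₁P ∂₂P − ∂₂P ∂₁P)) = Σ_m (⟨∂₁Φ_m, ∂₂Φ_m⟩ − ⟨∂₂Φ_m, ∂₁Φ_m⟩)` on `U`. -/
theorem trace_proj_comm_eq_sum_inner_derivs
    (N q : ℕ) (hN : 1 ≤ N) (hq : 1 ≤ q)
    (U : Set (ℝ × ℝ)) (hU : IsOpen U)
    (Φ : Fin q → (ℝ × ℝ) → EuclideanSpace ℂ (Fin N))
    (hΦ : ∀ m, ContDiffOn ℝ 1 (Φ m) U)
    (horth : ∀ φ ∈ U, ∀ m m' : Fin q,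
      ⟪Φ m φ, Φ m' φ⟫ = if m = m' then (1 : ℂ) else 0)
    (P : (ℝ × ℝ) → EuclideanSpace ℂ (Fin N) →L[ℂ] EuclideanSpace ℂ (Fin N))
    (hP : ∀ (φ : ℝ × ℝ) (x : EuclideanSpace ℂ (Fin N)), P φ x = ∑ m, ⟪Φ m φ, x⟫ • Φ m φ) :
    ∀ φ ∈ U,
      LinearMap.trace ℂ (EuclideanSpace ℂ (Fin N))
          ((P φ).toLinearMap ∘ₗ
            ((fderiv ℝ P φ (1, 0)).toLinearMap ∘ₗ (fderiv ℝ P φ (0, 1)).toLinearMap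
              - (fderiv ℝ P φ (0, 1)).toLinearMap ∘ₗ (fderiv ℝ P φ (1, 0)).toLinearMap))
        = ∑ m, (⟪fderiv ℝ (Φ m) φ (1, 0), fderiv ℝ (Φ m) φ (0, 1)⟫
            - ⟪fderiv ℝ (Φ m) φ (0, 1), fderiv ℝ (Φ m) φ (1, 0)⟫) := by
  intro φ hφ
  have hd (m : Fin q) : DifferentiableAt ℝ (Φ m) φ :=
    ((hΦ m).contDiffAt (hU.mem_nhds hφ)).differentiableAt one_ne_zero
  have hPeq : P = fun ψ => ∑ m, rankOne ℂ (Φ m ψ) (Φ m ψ) := by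
    funext ψ
    ext1 x
    simp [hP]
  have hinner (v : ℝ × ℝ) (m k : Fin q) :
      ⟪fderiv ℝ (Φ m) φ v, Φ k φ⟫ + ⟪Φ m φ, fderiv ℝ (Φ k) φ v⟫ = 0 := by
    have hconst : (fun ψ => ⟪Φ m ψ, Φ k ψ⟫) =ᶠ[nhds φ] fun _ => if m = k then (1 : ℂ) else 0 :=
      Filter.eventually_of_mem (hU.mem_nhds hφ) fun ψ hψ => horth ψ hψ m k
    rw [add_comm, ← fderiv_inner_apply ℂ (hd m) (hd k), hconst.fderiv_eq]
    simp
  subst hPeq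
  simp only [fderiv_sum_rankOne hd, trace_sum_rankOne_comp]
  simpa [inner_sub_right] using
    sum_inner_projDeriv_comm (horth φ hφ) (hinner (1, 0)) (hinner (0, 1))
end

section
/- Let P, Q, n be square complex matrices of the same size with P·P = P and Q = Q·P + P·Q. Then Tr( P · ( (n·P − P·n)·Q − Q·(n·P − P·n) ) ) = −Tr( n·Q ). -/
open Matrix

/-- Multiplying the Leibniz identity `q = qp + pq` by the idempotent `p` on both sides
gives `pqp = 0`. -/
theorem IsIdempotentElem.mul_mul_eq_zero_of_leibniz {R : Type*} [Ring R] {p q : R}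
    (hp : IsIdempotentElem p) (hq : q = q * p + p * q) : p * q * p = 0 := by
  have h : p * q * p = p * q * p + p * q * p := by
    calc p * q * p = p * (q * p + p * q) * p := by rw [← hq]
      _ = p * q * (p * p) + p * p * q * p := by noncomm_ring
      _ = p * q * p + p * q * p := by rw [hp.eq]
  exact left_eq_add.mp h

/-- If `P` is idempotent and `Q` satisfies the Leibniz identity `Q = QP + PQ`, then
`Tr(P ((nP − Pn)Q − Q(nP − Pn))) = −Tr(nQ)`. -/
theorem trace_idempotent_comm_eq_neg_trace
    {k : Type*} [Fintype k] [DecidableEq k]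
    (P Q n : Matrix k k ℂ) (hP : P * P = P) (hQ : Q = Q * P + P * Q) :
    Matrix.trace (P * ((n * P - P * n) * Q - Q * (n * P - P * n)))
      = -Matrix.trace (n * Q) := by
  have hPQP : P * Q * P = 0 := IsIdempotentElem.mul_mul_eq_zero_of_leibniz hP hQ
  have expand : P * ((n * P - P * n) * Q - Q * (n * P - P * n))
      = P * n * (P * Q) - P * P * n * Q - P * Q * n * P + P * Q * P * n := by
    noncomm_ring
  have h₁ : trace (P * n * (P * Q)) = 0 := by
    rw [mul_assoc, trace_mul_comm, mul_assoc, hPQP, mul_zero, trace_zero]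
  have h₂ : trace (P * n * Q) = trace (n * (Q * P)) := by
    rw [mul_assoc, trace_mul_comm, mul_assoc]
  have h₃ : trace (P * Q * n * P) = trace (n * (P * Q)) := by
    rw [trace_mul_comm, ← mul_assoc, ← mul_assoc, hP, trace_mul_comm]
  have h₄ : trace (n * Q) = trace (n * (Q * P)) + trace (n * (P * Q)) := by
    rw [← trace_add, ← mul_add, ← hQ]
  rw [expand, hP, hPQP, zero_mul, add_zero, trace_sub, trace_sub, h₁, h₂, h₃, h₄]
  ring
end

section
/- Let 𝓗 be a finite-dimensional complex inner product space, H a self-adjoint linear operator on 𝓗, and P, Q orthogonal projections on 𝓗 commuting with H (H∘P = P∘H and H∘Q = Q∘H). Let a ≤ b and c ≤ d be real numbers such that a·‖Px‖² ≤ Re⟨Px, H(Px)⟩ ≤ b·‖Px‖² and c·‖Qx‖² ≤ Re⟨Qx, H(Qx)⟩ ≤ d·‖Qx‖² for all x ∈ 𝓗. Then for every linear operator A on 𝓗, the traces T₀ := Tr(A^*∘Q∘A∘P) and X := Tr(A^*∘Q∘(H∘A − A∘H)∘P) are real numbers, T₀ ≥ 0, and (c − b)·T₀ ≤ X ≤ (d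 − a)·T₀. -/
local notation "⟪" x ", " y "⟫" => @inner ℂ _ _ x y

/-- If the quadratic form of a self-adjoint `H` lies between `c` and `d` times the squared norm on
the range of `B`, then `Tr(B* H B)` is real and lies between `c` and `d` times `Tr(B* B)`. -/
theorem exists_real_trace_conj_bounds
    {𝓗 : Type*} [NormedAddCommGroup 𝓗] [InnerProductSpace ℂ 𝓗] [FiniteDimensional ℂ 𝓗]
    (H B : Module.End ℂ 𝓗) (hH : IsSelfAdjoint H) (c d : ℝ)
    (h : ∀ x : 𝓗, c * ‖B x‖ ^ 2 ≤ (inner ℂ (B x) (H (B x))).re ∧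
      (inner ℂ (B x) (H (B x))).re ≤ d * ‖B x‖ ^ 2) :
    ∃ t s : ℝ, LinearMap.trace ℂ 𝓗 (star B * B) = (t : ℂ) ∧
      LinearMap.trace ℂ 𝓗 (star B * H * B) = (s : ℂ) ∧
      0 ≤ t ∧ c * t ≤ s ∧ s ≤ d * t := by
  have e := stdOrthonormalBasis ℂ 𝓗
  have hsymm := LinearMap.isSymmetric_iff_isSelfAdjoint H |>.mpr hH
  refine ⟨∑ i, ‖B (e i)‖ ^ 2, ∑ i, (inner ℂ (B (e i)) (H (B (e i)))).re, ?_, ?_,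
    Finset.sum_nonneg fun i _ => by positivity, ?_, ?_⟩
  · rw [LinearMap.trace_eq_sum_inner _ e]
    push_cast
    refine Finset.sum_congr rfl fun i _ => ?_
    rw [Module.End.mul_apply, LinearMap.star_eq_adjoint, LinearMap.adjoint_inner_right]
    exact inner_self_eq_norm_sq_to_K _
  · rw [LinearMap.trace_eq_sum_inner _ e]
    push_cast
    refine Finset.sum_congr rfl fun i _ => ?_
    rw [Module.End.mul_apply, Module.End.mul_apply, LinearMap.star_eq_adjoint,
      LinearMap.adjoint_inner_right]
    exact (hsymm.coe_re_inner_self_apply (B (e i))).symm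
  · rw [Finset.mul_sum]
    exact Finset.sum_le_sum fun i _ => (h (e i)).1
  · rw [Finset.mul_sum]
    exact Finset.sum_le_sum fun i _ => (h (e i)).2

/-- If `H` is self-adjoint, `P, Q` are orthogonal projections commuting with `H`, whose ranges
carry spectrum of `H` in `[a,b]` resp. `[c,d]`, then for every operator `A` the traces
`T₀ = Tr(A* Q A P)` and `X = Tr(A* Q (HA − AH) P)` are real, `T₀ ≥ 0`, and
`(c − b) T₀ ≤ X ≤ (d − a) T₀`. -/
theorem trace_commutator_bounds
    {𝓗 : Type*} [NormedAddCommGroup 𝓗] [InnerProductSpace ℂ 𝓗] [FiniteDimensional ℂ 𝓗]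
    (H P Q : 𝓗 →ₗ[ℂ] 𝓗)
    (hH : IsSelfAdjoint H)
    (hP : IsSelfAdjoint P) (hPidem : P ∘ₗ P = P)
    (hQ : IsSelfAdjoint Q) (hQidem : Q ∘ₗ Q = Q)
    (hHP : H ∘ₗ P = P ∘ₗ H) (hHQ : H ∘ₗ Q = Q ∘ₗ H)
    (a b c d : ℝ) (hab : a ≤ b) (hcd : c ≤ d)
    (hPspec : ∀ x : 𝓗, a * ‖P x‖ ^ 2 ≤ (⟪P x, H (P x)⟫).re ∧
      (⟪P x, H (P x)⟫).re ≤ b * ‖P x‖ ^ 2)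
    (hQspec : ∀ x : 𝓗, c * ‖Q x‖ ^ 2 ≤ (⟪Q x, H (Q x)⟫).re ∧
      (⟪Q x, H (Q x)⟫).re ≤ d * ‖Q x‖ ^ 2)
    (A : 𝓗 →ₗ[ℂ] 𝓗) :
    ∃ T₀ X : ℝ,
      LinearMap.trace ℂ 𝓗 (LinearMap.adjoint A ∘ₗ Q ∘ₗ A ∘ₗ P) = (T₀ : ℂ) ∧
      LinearMap.trace ℂ 𝓗 (LinearMap.adjoint A ∘ₗ Q ∘ₗ (H ∘ₗ A - A ∘ₗ H) ∘ₗ P) = (X : ℂ) ∧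
      0 ≤ T₀ ∧ (c - b) * T₀ ≤ X ∧ X ≤ (d - a) * T₀ := by
  change Module.End ℂ 𝓗 at H P Q A
  change P * P = P at hPidem
  change Q * Q = Q at hQidem
  change H * P = P * H at hHP
  change H * Q = Q * H at hHQ
  change ∃ T₀ X : ℝ, LinearMap.trace ℂ 𝓗 (star A * (Q * (A * P))) = (T₀ : ℂ) ∧
    LinearMap.trace ℂ 𝓗 (star A * (Q * ((H * A - A * H) * P))) = (X : ℂ) ∧ _
  have hPs : star P = P := hP
  have hQs : star Q = Q := hQ
  have hPP (Z : Module.End ℂ 𝓗) : P * (P * Z) = P * Z := by rw [← mul_assoc, hPidem]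
  have hQQ (Z : Module.End ℂ 𝓗) : Q * (Q * Z) = Q * Z := by rw [← mul_assoc, hQidem]
  have hHP' (Z : Module.End ℂ 𝓗) : H * (P * Z) = P * (H * Z) := by
    rw [← mul_assoc, hHP, mul_assoc]
  have hHQ' (Z : Module.End ℂ 𝓗) : H * (Q * Z) = Q * (H * Z) := by
    rw [← mul_assoc, hHQ, mul_assoc]
  obtain ⟨t, s, ht, hs, ht0, hcs, hsd⟩ :=
    exists_real_trace_conj_bounds H (Q * A * P) hH c d fun x => hQspec (A (P x))
  obtain ⟨t', r, ht', hr, -, har, hrb⟩ :=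
    exists_real_trace_conj_bounds H (star (Q * A * P)) hH a b fun x => by
      simpa [hPs, hQs, mul_assoc] using hPspec (star A (Q x))
  have htt : t' = t := by
    rw [← Complex.ofReal_inj, ← ht, ← ht', star_star, LinearMap.trace_mul_comm]
  subst htt
  have hT : LinearMap.trace ℂ 𝓗 (star A * (Q * (A * P))) =
      LinearMap.trace ℂ 𝓗 (star (Q * A * P) * (Q * A * P)) := by
    simp only [star_mul, hPs, hQs, mul_assoc, hQQ]
    rw [LinearMap.trace_mul_comm ℂ P]
    simp only [mul_assoc, hPidem]
  have hS : LinearMap.trace ℂ 𝓗 (star A * (Q * (H * (A * P)))) =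
      LinearMap.trace ℂ 𝓗 (star (Q * A * P) * H * (Q * A * P)) := by
    simp only [star_mul, hPs, hQs, mul_assoc, hHQ', hQQ]
    rw [LinearMap.trace_mul_comm ℂ P]
    simp only [mul_assoc, hPidem]
  have hR : LinearMap.trace ℂ 𝓗 (star A * (Q * (A * (H * P)))) =
      LinearMap.trace ℂ 𝓗 (star (star (Q * A * P)) * H * star (Q * A * P)) := by
    simp only [star_star, star_mul, hPs, hQs, mul_assoc, hHP', hPP]
    rw [LinearMap.trace_mul_comm ℂ Q, LinearMap.trace_mul_comm ℂ (star A), hHP]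
    simp only [mul_assoc, hQidem]
    rw [← mul_assoc A, ← mul_assoc (A * P), LinearMap.trace_mul_comm ℂ Q]
    simp only [mul_assoc]
  refine ⟨t', s - r, hT.trans ht, ?_, ht0, by linarith, by linarith⟩
  rw [sub_mul, mul_sub, mul_sub, map_sub, mul_assoc H, mul_assoc A, hS, hR, hs, hr,
    Complex.ofReal_sub]
end

section
/- Let 𝓗 be a finite-dimensional complex inner product space, H a self-adjoint linear operator on 𝓗, and P an orthogonal projection on 𝓗 commuting with H (H∘P = P∘H). Let a ≤ b be real numbers with a·‖Px‖² ≤ Re⟨Px, H(Px)⟩ ≤ b·‖Px‖² for all x ∈ 𝓗. Then for every linear operator A on 𝓗, the traces Tr(A^*∘P∘(H∘A − A∘H)∘P) and Tr(A^*∘P∘A∘P) are real, and |Tr(A^*∘P∘(H∘A − A∘H)∘P)| ≤ (b − a)·Tr(A^*∘P∘A∘P). -/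
local notation "⟪" x ", " y "⟫" => @inner ℂ _ _ x y

/-- If the quadratic form of a self-adjoint `H` is bounded by `a` and `b` times the squared norm
on the range of `C`, then `Tr(C* H C)` and `Tr(C* C)` are real, and the former lies between `a` and
`b` times the latter. -/
theorem exists_trace_conj_bounds
    {E : Type*} [NormedAddCommGroup E] [InnerProductSpace ℂ E] [FiniteDimensional ℂ E]
    {H C : E →ₗ[ℂ] E} (hH : IsSelfAdjoint H) {a b : ℝ}
    (h : ∀ x : E, a * ‖C x‖ ^ 2 ≤ (⟪C x, H (C x)⟫).re ∧ (⟪C x, H (C x)⟫).re ≤ b * ‖C x‖ ^ 2) :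
    ∃ X T : ℝ, LinearMap.trace ℂ E (star C * (H * C)) = (X : ℂ) ∧
      LinearMap.trace ℂ E (star C * C) = (T : ℂ) ∧ a * T ≤ X ∧ X ≤ b * T := by
  have hsymm : H.IsSymmetric := (LinearMap.isSymmetric_iff_isSelfAdjoint H).2 hH
  let e := stdOrthonormalBasis ℂ E
  refine ⟨∑ i, (⟪C (e i), H (C (e i))⟫).re, ∑ i, ‖C (e i)‖ ^ 2, ?_, ?_, ?_, ?_⟩
  · rw [LinearMap.trace_eq_sum_inner _ e, Complex.ofReal_sum]
    refine Finset.sum_congr rfl fun i _ => ?_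
    rw [Module.End.mul_apply, Module.End.mul_apply, LinearMap.star_eq_adjoint,
      LinearMap.adjoint_inner_right]
    exact (Complex.conj_eq_iff_re.1 (by rw [inner_conj_symm, hsymm])).symm
  · rw [LinearMap.trace_eq_sum_inner _ e, Complex.ofReal_sum]
    refine Finset.sum_congr rfl fun i _ => ?_
    rw [Module.End.mul_apply, LinearMap.star_eq_adjoint, LinearMap.adjoint_inner_right,
      inner_self_eq_norm_sq_to_K]
    norm_cast
  · rw [Finset.mul_sum]
    exact Finset.sum_le_sum fun i _ => (h (e i)).1
  · rw [Finset.mul_sum]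
    exact Finset.sum_le_sum fun i _ => (h (e i)).2

/-- If `H` is self-adjoint and `P` is an orthogonal projection commuting with `H` whose range
carries spectrum of `H` in `[a,b]`, then for every operator `A` the traces
`Tr(A* P (HA − AH) P)` and `Tr(A* P A P)` are real and
`|Tr(A* P (HA − AH) P)| ≤ (b − a) Tr(A* P A P)`. -/
theorem abs_trace_commutator_le
    {𝓗 : Type*} [NormedAddCommGroup 𝓗] [InnerProductSpace ℂ 𝓗] [FiniteDimensional ℂ 𝓗]
    (H P : 𝓗 →ₗ[ℂ] 𝓗)
    (hH : IsSelfAdjoint H)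
    (hP : IsSelfAdjoint P) (hPidem : P ∘ₗ P = P)
    (hHP : H ∘ₗ P = P ∘ₗ H)
    (a b : ℝ) (hab : a ≤ b)
    (hPspec : ∀ x : 𝓗, a * ‖P x‖ ^ 2 ≤ (⟪P x, H (P x)⟫).re ∧
      (⟪P x, H (P x)⟫).re ≤ b * ‖P x‖ ^ 2)
    (A : 𝓗 →ₗ[ℂ] 𝓗) :
    ∃ X T : ℝ,
      LinearMap.trace ℂ 𝓗 (LinearMap.adjoint A ∘ₗ P ∘ₗ (H ∘ₗ A - A ∘ₗ H) ∘ₗ P) = (X : ℂ) ∧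
      LinearMap.trace ℂ 𝓗 (LinearMap.adjoint A ∘ₗ P ∘ₗ A ∘ₗ P) = (T : ℂ) ∧
      |X| ≤ (b - a) * T := by
  have hPP : P * P = P := hPidem
  have hcomm : H * P = P * H := hHP
  have hPP' (Z : 𝓗 →ₗ[ℂ] 𝓗) : P * (P * Z) = P * Z := by rw [← mul_assoc, hPP]
  have hcomm' (Z : 𝓗 →ₗ[ℂ] 𝓗) : H * (P * Z) = P * (H * Z) := by
    rw [← mul_assoc, hcomm, mul_assoc]
  have hbound (Z : 𝓗 →ₗ[ℂ] 𝓗) (x : 𝓗) := hPspec (Z x)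
  have hstar : star (P * (A * P)) = P * (star A * P) := by
    rw [star_mul, star_mul, hP.star_eq, mul_assoc]
  have hstar' : star (P * (star A * P)) = P * (A * P) := by rw [← hstar, star_star]
  obtain ⟨X, T, hX, hT, haX, hXb⟩ :=
    exists_trace_conj_bounds (C := P * (A * P)) hH (hbound (A * P))
  obtain ⟨Y, S, hY, hS, haY, hYb⟩ :=
    exists_trace_conj_bounds (C := P * (star A * P)) hH (hbound (star A * P))
  have hST : S = T := by
    rw [hstar', LinearMap.trace_mul_comm, ← hstar, hT] at hS
    exact_mod_cast hS.symm
  subst hST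
  have hX' : LinearMap.trace ℂ 𝓗 (star A * (P * (H * (A * P)))) = X := by
    rw [← hX, hstar, mul_assoc P, LinearMap.trace_mul_comm _ P]
    simp only [mul_assoc, hPP, hPP', hcomm']
  have hY' : LinearMap.trace ℂ 𝓗 (star A * (P * (A * (H * P)))) = Y := by
    rw [← hY, hstar', mul_assoc P (A * P), LinearMap.trace_mul_comm _ P,
      show A * P * (H * (P * (star A * P))) * P = A * (H * P) * (star A * P) by
        simp only [mul_assoc, hPP, hPP', hcomm'],
      LinearMap.trace_mul_comm _ (A * (H * P)), mul_assoc (star A)]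
  refine ⟨X - Y, S, ?_, ?_, ?_⟩
  · change LinearMap.trace ℂ 𝓗 (star A * (P * ((H * A - A * H) * P))) = _
    simp only [sub_mul, mul_sub, mul_assoc, map_sub, hX', hY', Complex.ofReal_sub]
  · change LinearMap.trace ℂ 𝓗 (star A * (P * (A * P))) = _
    rw [← hT, hstar, mul_assoc P, LinearMap.trace_mul_comm _ P]
    simp only [mul_assoc, hPP, hPP']
  · rw [abs_le]
    constructor <;> linarith
end

section
/- For all real numbers Δ, Δ₀, η, T with Δ ≥ Δ₀ > 0, η > 0 and T > 0, one has | ∫_{−T}^{0} s · exp((η − iΔ)·s) ds − 1/Δ² | ≤ (2Δ₀ + η)·η/Δ₀⁴ + (1 + T·Δ₀)·exp(−ηT)/Δ₀². -/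
open Real intervalIntegral

/-- The integral of `s * exp (c * s)` over `[-T, 0]`, by the fundamental theorem of calculus. -/
theorem integral_ofReal_mul_cexp {c : ℂ} (hc : c ≠ 0) (T : ℝ) :
    ∫ s in (-T)..(0 : ℝ), (s : ℂ) * Complex.exp (c * s)
      = -(1 / c ^ 2) + (T / c + 1 / c ^ 2) * Complex.exp (-(c * T)) := by
  have hderiv : ∀ s : ℝ, HasDerivAt
      (fun s : ℝ => ((s : ℂ) / c - 1 / c ^ 2) * Complex.exp (c * s))
      ((s : ℂ) * Complex.exp (c * s)) s := by
    intro s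
    have hid : HasDerivAt (fun s : ℝ => (s : ℂ)) 1 s := Complex.ofRealCLM.hasDerivAt
    have h := ((hid.div_const c).sub_const (1 / c ^ 2)).mul ((hid.const_mul c).cexp)
    refine h.congr_deriv ?_
    field_simp
    ring
  rw [integral_eq_sub_of_hasDerivAt (fun s _ => hderiv s)
    (Continuous.intervalIntegrable (by fun_prop) _ _)]
  simp only [Complex.ofReal_neg, Complex.ofReal_zero, mul_zero, Complex.exp_zero, mul_neg]
  ring

/-- For `Δ ≥ Δ₀ > 0`, `η > 0`, `T > 0`:
`|∫_{−T}^0 s e^{(η − iΔ)s} ds − 1/Δ²| ≤ (2Δ₀ + η)η/Δ₀⁴ + (1 + TΔ₀)e^{−ηT}/Δ₀²`. -/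
theorem abs_integral_s_exp_sub_inv_sq_le
    (Δ Δ₀ η T : ℝ) (hΔ : Δ₀ ≤ Δ) (hΔ₀ : 0 < Δ₀) (hη : 0 < η) (hT : 0 < T) :
    ‖(∫ s in (-T)..(0:ℝ), (s : ℂ) * Complex.exp (((η : ℂ) - Complex.I * Δ) * s))
        - 1 / (Δ : ℂ) ^ 2‖
      ≤ (2 * Δ₀ + η) * η / Δ₀ ^ 4 + (1 + T * Δ₀) * Real.exp (-η * T) / Δ₀ ^ 2 := by
  have hΔpos : 0 < Δ := hΔ₀.trans_le hΔ
  have hΔne : (Δ : ℂ) ≠ 0 := by exact_mod_cast hΔpos.ne'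
  set c : ℂ := (η : ℂ) - Complex.I * Δ with hcdef
  have hΔc : Δ ≤ ‖c‖ := by
    have h := Complex.abs_im_le_norm c
    have him : c.im = -Δ := by simp [hcdef]
    rwa [him, abs_neg, abs_of_pos hΔpos] at h
  have hΔ₀c : Δ₀ ≤ ‖c‖ := hΔ.trans hΔc
  have hc : c ≠ 0 := norm_pos_iff.mp (hΔpos.trans_le hΔc)
  have hexp : ‖Complex.exp (-(c * T))‖ = Real.exp (-η * T) := by
    rw [Complex.norm_exp]
    simp [hcdef]
  have hmain : ‖-(1 / c ^ 2) - 1 / (Δ : ℂ) ^ 2‖ ≤ (2 * Δ₀ + η) * η / Δ₀ ^ 4 := by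
    have hsplit : -(1 / c ^ 2) - 1 / (Δ : ℂ) ^ 2
        = -(η * (η - 2 * Complex.I * Δ)) / (c ^ 2 * (Δ : ℂ) ^ 2) := by
      field_simp
      rw [hcdef]
      linear_combination (-(Δ : ℂ) ^ 2) * Complex.I_sq
    have hnum : ‖(η : ℂ) - 2 * Complex.I * Δ‖ ≤ 2 * Δ + η := by
      refine (norm_sub_le _ _).trans_eq ?_
      simp [abs_of_pos hη, abs_of_pos hΔpos, add_comm]
    rw [hsplit, norm_div, norm_neg, norm_mul, norm_mul, norm_pow, norm_pow,
      Complex.norm_of_nonneg hη.le, Complex.norm_of_nonneg hΔpos.le]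
    calc η * ‖(η : ℂ) - 2 * Complex.I * Δ‖ / (‖c‖ ^ 2 * Δ ^ 2)
        ≤ η * (2 * Δ + η) / (Δ ^ 2 * Δ ^ 2) := by gcongr
      _ = 2 * η / Δ ^ 3 + η ^ 2 / Δ ^ 4 := by field_simp
      _ ≤ 2 * η / Δ₀ ^ 3 + η ^ 2 / Δ₀ ^ 4 := by gcongr
      _ = (2 * Δ₀ + η) * η / Δ₀ ^ 4 := by field_simp
  have htail : ‖(T / c + 1 / c ^ 2) * Complex.exp (-(c * T))‖
      ≤ (1 + T * Δ₀) * Real.exp (-η * T) / Δ₀ ^ 2 := by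
    rw [norm_mul, hexp]
    calc ‖(T : ℂ) / c + 1 / c ^ 2‖ * Real.exp (-η * T)
        ≤ (T / Δ₀ + 1 / Δ₀ ^ 2) * Real.exp (-η * T) := by
          gcongr
          refine (norm_add_le _ _).trans ?_
          rw [norm_div, norm_div, norm_pow, norm_one, Complex.norm_of_nonneg hT.le]
          gcongr
      _ = (1 + T * Δ₀) * Real.exp (-η * T) / Δ₀ ^ 2 := by
          field_simp
          ring
  rw [integral_ofReal_mul_cexp hc, add_sub_right_comm]
  exact (norm_add_le _ _).trans (add_le_add hmain htail)
end

section
/- Let N ≥ q ≥ 1 and let P : ℝ × ℝ → M_N(ℂ) be a smooth (infinitely differentiable) family of N×N complex matrices such that for every φ ∈ ℝ², P(φ) is Hermitian, P(φ)·P(φ) = P(φ), and P(φ) has rank q. Then there exist smooth maps Φ₁, …, Φ_q : ℝ × ℝ → ℂ^N that are pointwise orthonormal, ⟨Φ_m(φ), Φ_{m′}(φ)⟩ = δ_{m m′} for all φ and all m, m′, and such that for every φ the range of P(φ) is spanned by Φ₁(φ), …, Φ_q(φ); equivalently, P(φ)x = Σ_{m=1}^q ⟨Φ_m(φ), x⟩·Φ_m(φ)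 for all x ∈ ℂ^N. -/
open Matrix

attribute [local instance] Matrix.normedAddCommGroup Matrix.normedSpace

open scoped ContDiff

section MovingFrame

variable {E : Type*} [NormedAddCommGroup E] [NormedSpace ℝ E] {N q : ℕ}

theorem ContDiff.matrix_mulVec {P : E → Matrix (Fin N) (Fin N) ℂ} {v : E → Fin N → ℂ}
    (hP : ContDiff ℝ ∞ P) (hv : ContDiff ℝ ∞ v) : ContDiff ℝ ∞ fun φ => P φ *ᵥ v φ := by
  refine contDiff_pi.2 fun i => ?_
  have hP' : ∀ j, ContDiff ℝ ∞ fun φ => P φ i j := fun j =>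
    contDiff_pi.1 ((contDiff_pi (Φ := fun φ i => P φ i)).1 hP i) j
  simp only [mulVec, dotProduct]
  exact ContDiff.sum fun j _ => (hP' j).mul (contDiff_pi.1 hv j)

theorem Matrix.norm_mulVec_le_card_mul (M : Matrix (Fin N) (Fin N) ℂ) (x : Fin N → ℂ) :
    ‖M *ᵥ x‖ ≤ N * ‖M‖ * ‖x‖ := by
  refine (pi_norm_le_iff_of_nonneg (by positivity)).2 fun i => ?_
  calc ‖(M *ᵥ x) i‖ ≤ ∑ j, ‖M i j * x j‖ := norm_sum_le Finset.univ fun j => M i j * x j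
    _ ≤ ∑ _j : Fin N, ‖M‖ * ‖x‖ := Finset.sum_le_sum fun j _ => by
        rw [norm_mul]
        gcongr
        · exact M.norm_entry_le_entrywise_sup_norm
        · exact norm_le_pi_norm x j
    _ = N * ‖M‖ * ‖x‖ := by simp [mul_assoc]

/-- A smooth family of linearly independent vectors fixed by the matrices `P φ`. -/
structure IsMovingFrame (P : E → Matrix (Fin N) (Fin N) ℂ) (v : Fin q → E → Fin N → ℂ) :
    Prop where
  contDiff : ∀ i, ContDiff ℝ ∞ (v i)
  linearIndependent : ∀ φ, LinearIndependent ℂ fun i => v i φ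
  mulVec_eq : ∀ φ i, P φ *ᵥ v i φ = v i φ

/-- Projecting a moving frame onto the range of a nearby family of projections. -/
theorem IsMovingFrame.project {P Q : E → Matrix (Fin N) (Fin N) ℂ} {v : Fin q → E → Fin N → ℂ}
    (hv : IsMovingFrame P v) (hQ : ContDiff ℝ ∞ Q) (hidem : ∀ φ, Q φ * Q φ = Q φ)
    (hclose : ∀ φ, N * ‖P φ - Q φ‖ < 1) :
    IsMovingFrame Q fun i φ => Q φ *ᵥ v i φ where
  contDiff i := hQ.matrix_mulVec (hv.contDiff i)
  mulVec_eq φ i := by rw [mulVec_mulVec, hidem]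
  linearIndependent φ := by
    refine (hv.linearIndependent φ).map (f := (Q φ).mulVecLin) ?_
    rw [Submodule.disjoint_def]
    intro x hx hker
    have hfix : P φ *ᵥ x = x := by
      have hle : Submodule.span ℂ (Set.range fun i => v i φ) ≤
          LinearMap.eqLocus (P φ).mulVecLin LinearMap.id := by
        rw [Submodule.span_le]
        rintro _ ⟨i, rfl⟩
        exact hv.mulVec_eq φ i
      exact hle hx
    have hQx : Q φ *ᵥ x = 0 := hker
    have hle := Matrix.norm_mulVec_le_card_mul (P φ - Q φ) x
    rw [sub_mulVec, hfix, hQx, sub_zero] at hle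
    by_contra hne
    nlinarith [hclose φ, norm_pos_iff.2 hne]

/-- Transporting a moving frame along a discrete path of families of projections. -/
theorem IsMovingFrame.exists_transport {P : ℕ → E → Matrix (Fin N) (Fin N) ℂ}
    {v : Fin q → E → Fin N → ℂ} (hv : IsMovingFrame (P 0) v)
    (hP : ∀ k, ContDiff ℝ ∞ (P k)) (hidem : ∀ k φ, P k φ * P k φ = P k φ) (m : ℕ)
    (hclose : ∀ k < m, ∀ φ, N * ‖P k φ - P (k + 1) φ‖ < 1) :
    ∃ w : Fin q → E → Fin N → ℂ, IsMovingFrame (P m) w ∧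
      ∀ φ, (∀ k, P k φ = P 0 φ) → ∀ i, w i φ = v i φ := by
  induction m with
  | zero => exact ⟨v, hv, fun _ _ _ => rfl⟩
  | succ m ih =>
    obtain ⟨w, hw, hwv⟩ := ih fun k hk => hclose k (by omega)
    refine ⟨_, hw.project (hP (m + 1)) (hidem (m + 1)) (hclose m (by omega)), ?_⟩
    intro φ hφ i
    rw [hwv φ hφ i, hφ (m + 1), hv.mulVec_eq]

/-- Bounded smooth maps into a finite-dimensional space are joined by a straight-line homotopy,
along which a moving frame of the pulled-back projections can be transported. -/
theorem IsMovingFrame.exists_comp_of_bounded [FiniteDimensional ℝ E]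
    {P : E → Matrix (Fin N) (Fin N) ℂ} (hP : ContDiff ℝ ∞ P) (hidem : ∀ φ, P φ * P φ = P φ)
    {f g : E → E} (hf : ContDiff ℝ ∞ f) (hg : ContDiff ℝ ∞ g) {R : ℝ}
    (hfR : ∀ φ, ‖f φ‖ ≤ R) (hgR : ∀ φ, ‖g φ‖ ≤ R)
    {v : Fin q → E → Fin N → ℂ} (hv : IsMovingFrame (P ∘ f) v) :
    ∃ w : Fin q → E → Fin N → ℂ, IsMovingFrame (P ∘ g) w ∧
      ∀ φ, f φ = g φ → ∀ i, w i φ = v i φ := by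
  have hK : IsCompact (Metric.closedBall (0 : E) R) := isCompact_closedBall 0 R
  have huc := hK.uniformContinuousOn_of_continuous hP.continuous.continuousOn
  obtain ⟨δ, hδ, hPδ⟩ := Metric.uniformContinuousOn_iff.1 huc (1 / (N + 1)) (by positivity)
  obtain ⟨m, hm⟩ := exists_nat_gt (2 * R / δ)
  have hR : 0 ≤ R := (norm_nonneg _).trans (hfR 0)
  have hm0 : (0 : ℝ) < m := lt_of_le_of_lt (by positivity) hm
  let σ : ℕ → E → E := fun k φ => f φ + ((k : ℝ) / m) • (g φ - f φ)
  have hσ : ∀ k ≤ m, ∀ φ, σ k φ ∈ Metric.closedBall (0 : E) R := fun k hk φ => by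
    refine (convex_closedBall (0 : E) R).add_smul_sub_mem (by simpa using hfR φ)
      (by simpa using hgR φ) ⟨by positivity, ?_⟩
    rw [div_le_one hm0]
    exact_mod_cast hk
  have hσ0 : P ∘ σ 0 = P ∘ f := by ext1 φ; simp [σ]
  have hσm : P ∘ σ m = P ∘ g := by ext1 φ; simp [σ, div_self hm0.ne']
  have hclose : ∀ k < m, ∀ φ, N * ‖(P ∘ σ k) φ - (P ∘ σ (k + 1)) φ‖ < 1 := by
    intro k hk φ
    have hdist : dist (σ k φ) (σ (k + 1) φ) < δ := by
      have hsub : σ k φ - σ (k + 1) φ = (1 / (m : ℝ)) • (f φ - g φ) := by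
        simp only [σ, Nat.cast_add, Nat.cast_one, add_div]
        module
      rw [dist_eq_norm, hsub, norm_smul, Real.norm_of_nonneg (by positivity),
        one_div_mul_eq_div, div_lt_iff₀ hm0]
      rw [div_lt_iff₀ hδ] at hm
      linarith [norm_sub_le (f φ) (g φ), hfR φ, hgR φ]
    have h := hPδ _ (hσ k hk.le φ) _ (hσ (k + 1) hk φ) hdist
    rw [dist_eq_norm, lt_div_iff₀ (by positivity)] at h
    simp only [Function.comp_apply]
    nlinarith [norm_nonneg (P (σ k φ) - P (σ (k + 1) φ))]
  obtain ⟨w, hw, hwv⟩ := IsMovingFrame.exists_transport (P := fun k => P ∘ σ k)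
    (v := v) (by rwa [hσ0])
    (fun k => hP.comp (hf.add (contDiff_const.smul (hg.sub hf)))) (fun k φ => hidem _) m hclose
  refine ⟨w, by rwa [hσm] at hw, fun φ hφ => hwv φ fun k => ?_⟩
  simp [σ, hφ]

/-- A smooth family of projections of rank `q` on a finite-dimensional space admits a global
moving frame. -/
theorem exists_isMovingFrame [FiniteDimensional ℝ E]
    {P : E → Matrix (Fin N) (Fin N) ℂ} (hP : ContDiff ℝ ∞ P) (hidem : ∀ φ, P φ * P φ = P φ)
    (hrank : (P 0).rank = q) : ∃ v : Fin q → E → Fin N → ℂ, IsMovingFrame P v := by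
  let bump : ℕ → ContDiffBump (0 : E) := fun n => ⟨n + 1, n + 2, by positivity, by linarith⟩
  let γ : ℕ → E → E := fun n => n.casesOn (fun _ => 0) fun n φ => bump n φ • φ
  have hγ : ∀ n, ContDiff ℝ ∞ (γ n) := by
    rintro (_ | n)
    · exact contDiff_const
    · exact (bump n).contDiff.smul contDiff_id
  have hγ_bound : ∀ (n : ℕ) φ, ‖γ n φ‖ ≤ n + 1 := by
    rintro (_ | n) φ
    · simp [γ]
    · change ‖bump n φ • φ‖ ≤ _
      rw [norm_smul, Real.norm_of_nonneg (bump n).nonneg]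
      by_cases hφ : ‖φ‖ ≤ n + 2
      · push_cast
        nlinarith [(bump n).le_one (x := φ), norm_nonneg φ, (bump n).nonneg (x := φ)]
      · rw [(bump n).zero_of_le_dist (by simpa [bump] using (not_le.1 hφ).le)]
        simp only [zero_mul]
        positivity
  have hγ_id : ∀ (n : ℕ) φ, ‖φ‖ ≤ n → γ n φ = φ := by
    rintro (_ | n) φ hφ
    · simpa [γ, eq_comm] using hφ
    · change bump n φ • φ = φ
      rw [(bump n).one_of_mem_closedBall (by simpa [bump] using hφ), one_smul]
  obtain ⟨v₀, hv₀⟩ : ∃ v : Fin q → E → Fin N → ℂ, IsMovingFrame (P ∘ γ 0) v := by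
    let b := Module.finBasisOfFinrankEq ℂ (LinearMap.range (P 0).mulVecLin) hrank
    refine ⟨fun i _ => b i, fun i => contDiff_const, fun φ => ?_, fun φ i => ?_⟩
    · exact b.linearIndependent.map' (Submodule.subtype _) (Submodule.ker_subtype _)
    · obtain ⟨x, hx⟩ := (b i).2
      rw [← hx]
      simp [γ, mulVec_mulVec, hidem]
  have hstep : ∀ n (v : {v : Fin q → E → Fin N → ℂ // IsMovingFrame (P ∘ γ n) v}),
      ∃ w : {w : Fin q → E → Fin N → ℂ // IsMovingFrame (P ∘ γ (n + 1)) w},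
        ∀ φ, ‖φ‖ ≤ n → ∀ i, w.1 i φ = v.1 i φ := by
    rintro n ⟨v, hv⟩
    obtain ⟨w, hw, hwv⟩ := hv.exists_comp_of_bounded hP hidem (hγ n) (hγ (n + 1)) (R := n + 2)
      (fun φ => (hγ_bound n φ).trans (by linarith))
      (fun φ => (hγ_bound (n + 1) φ).trans (by push_cast; linarith))
    refine ⟨⟨w, hw⟩, fun φ hφ => hwv φ ?_⟩
    rw [hγ_id n φ hφ, hγ_id (n + 1) φ (hφ.trans (by simp))]
  choose step hstep_eq using hstep
  let F : ∀ n, {v : Fin q → E → Fin N → ℂ // IsMovingFrame (P ∘ γ n) v} :=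
    fun n => Nat.rec ⟨v₀, hv₀⟩ step n
  have hF : ∀ φ n, ⌈‖φ‖⌉₊ ≤ n → ∀ i, (F n).1 i φ = (F ⌈‖φ‖⌉₊).1 i φ := by
    intro φ n hn
    induction n, hn using Nat.le_induction with
    | base => exact fun i => rfl
    | succ n hn ih => exact fun i => (hstep_eq n (F n) φ (Nat.ceil_le.1 hn) i).trans (ih i)
  refine ⟨fun i φ => (F ⌈‖φ‖⌉₊).1 i φ, fun i => ?_, fun φ => ?_, fun φ i => ?_⟩
  · refine contDiff_iff_contDiffAt.2 fun φ => ?_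
    refine ((F (⌈‖φ‖⌉₊ + 1)).2.contDiff i).contDiffAt.congr_of_eventuallyEq ?_
    have hlt : ‖φ‖ < (⌈‖φ‖⌉₊ + 1 : ℕ) := by
      push_cast
      linarith [Nat.le_ceil ‖φ‖]
    filter_upwards [continuous_norm.continuousAt.eventually_lt continuousAt_const hlt] with ψ hψ
    exact (hF ψ _ (Nat.ceil_le.2 hψ.le) i).symm
  · exact (F _).2.linearIndependent φ
  · have h := (F ⌈‖φ‖⌉₊).2.mulVec_eq φ i
    rwa [Function.comp_apply, hγ_id _ φ (Nat.le_ceil _)] at h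

end MovingFrame

section GramSchmidt

variable {E : Type*} [NormedAddCommGroup E] [NormedSpace ℝ E]
  {H : Type*} [NormedAddCommGroup H] [InnerProductSpace ℂ H] [NormedSpace ℝ H]
  [IsScalarTower ℝ ℂ H] {q : ℕ}

open InnerProductSpace

theorem contDiff_gramSchmidt {v : Fin q → E → H} (hv : ∀ i, ContDiff ℝ ∞ (v i))
    (hli : ∀ φ, LinearIndependent ℂ fun i => v i φ) (i : Fin q) :
    ContDiff ℝ ∞ fun φ => gramSchmidt ℂ (fun j => v j φ) i := by
  induction i using WellFoundedLT.induction with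
  | ind i ih =>
    simp only [gramSchmidt_def ℂ _ i, Submodule.starProjection_singleton]
    refine (hv i).sub (ContDiff.sum fun j hj => ?_)
    have hj := ih j (Finset.mem_Iio.1 hj)
    simp only [div_eq_mul_inv]
    refine ((hj.inner ℂ (hv i)).mul (ContDiff.inv ?_ fun φ => ?_)).smul hj
    · exact Complex.ofRealCLM.contDiff.comp (hj.norm_sq ℂ)
    · simpa using gramSchmidt_ne_zero j (hli φ)

theorem contDiff_gramSchmidtNormed {v : Fin q → E → H} (hv : ∀ i, ContDiff ℝ ∞ (v i))
    (hli : ∀ φ, LinearIndependent ℂ fun i => v i φ) (i : Fin q) :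
    ContDiff ℝ ∞ fun φ => gramSchmidtNormed ℂ (fun j => v j φ) i := by
  have hg := contDiff_gramSchmidt hv hli i
  have hne : ∀ φ, gramSchmidt ℂ (fun j => v j φ) i ≠ 0 := fun φ => gramSchmidt_ne_zero i (hli φ)
  have hnorm := Complex.ofRealCLM.contDiff.comp (hg.norm ℂ hne)
  exact (hnorm.inv fun φ => by simpa using hne φ).smul hg

end GramSchmidt

/-- A smooth family of rank-`q` Hermitian projections `P : ℝ² → M_N(ℂ)` admits a smooth global
orthonormal frame `Φ₁, …, Φ_q` of its range: pointwise orthonormal vectors with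
`P(φ) x = Σ_m ⟨Φ_m(φ), x⟩ Φ_m(φ)` for all `x`. -/
theorem exists_smooth_orthonormal_frame
    (N q : ℕ) (hq : 1 ≤ q) (hqN : q ≤ N)
    (P : ℝ × ℝ → Matrix (Fin N) (Fin N) ℂ)
    (hsmooth : ContDiff ℝ (⊤ : ℕ∞) P)
    (hherm : ∀ φ : ℝ × ℝ, (P φ).IsHermitian)
    (hidem : ∀ φ : ℝ × ℝ, P φ * P φ = P φ)
    (hrank : ∀ φ : ℝ × ℝ, (P φ).rank = q) :
    ∃ Φ : Fin q → (ℝ × ℝ) → (Fin N → ℂ),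
      (∀ m, ContDiff ℝ (⊤ : ℕ∞) (Φ m)) ∧
      (∀ (φ : ℝ × ℝ) (m m' : Fin q),
        star (Φ m φ) ⬝ᵥ Φ m' φ = if m = m' then (1 : ℂ) else 0) ∧
      (∀ (φ : ℝ × ℝ) (x : Fin N → ℂ),
        (P φ) *ᵥ x = ∑ m, (star (Φ m φ) ⬝ᵥ x) • Φ m φ) := by
  obtain ⟨v, hv⟩ := exists_isMovingFrame hsmooth hidem (hrank 0)
  let u : Fin q → ℝ × ℝ → EuclideanSpace ℂ (Fin N) := fun i φ => WithLp.toLp 2 (v i φ)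
  have hu : ∀ i, ContDiff ℝ ∞ (u i) := fun i =>
    (contDiff_piLp 2).2 fun j => contDiff_pi.1 (hv.contDiff i) j
  have hli : ∀ φ, LinearIndependent ℂ fun i => u i φ := fun φ =>
    (hv.linearIndependent φ).map' (WithLp.linearEquiv 2 ℂ (Fin N → ℂ)).symm.toLinearMap
      (LinearEquiv.ker _)
  let e : ℝ × ℝ → Fin q → EuclideanSpace ℂ (Fin N) := fun φ =>
    InnerProductSpace.gramSchmidtNormed ℂ fun i => u i φ
  have he : ∀ φ, Orthonormal ℂ (e φ) := fun φ =>
    InnerProductSpace.gramSchmidtNormed_orthonormal (hli φ)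
  have horth : ∀ (φ : ℝ × ℝ) (m m' : Fin q),
      star ((e φ m).ofLp) ⬝ᵥ (e φ m').ofLp = if m = m' then (1 : ℂ) else 0 := fun φ m m' => by
    rw [dotProduct_comm, ← EuclideanSpace.inner_eq_star_dotProduct]
    exact orthonormal_iff_ite.1 (he φ) m m'
  have hfix : ∀ φ m, P φ *ᵥ (e φ m).ofLp = (e φ m).ofLp := by
    intro φ m
    let T := Matrix.toEuclideanLin (P φ)
    have hle : Submodule.span ℂ (Set.range fun i => u i φ) ≤ LinearMap.eqLocus T LinearMap.id := by
      rw [Submodule.span_le]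
      rintro _ ⟨i, rfl⟩
      exact congrArg (WithLp.toLp 2) (hv.mulVec_eq φ i)
    have hmem : e φ m ∈ Submodule.span ℂ (Set.range fun i => u i φ) := by
      rw [← InnerProductSpace.span_gramSchmidt, ← InnerProductSpace.span_gramSchmidtNormed_range]
      exact Submodule.subset_span ⟨m, rfl⟩
    exact congrArg WithLp.ofLp (hle hmem)
  refine ⟨fun m φ => (e φ m).ofLp, fun m => ?_, horth, fun φ x => ?_⟩
  · exact contDiff_pi.2 fun j => (contDiff_piLp 2).1 (contDiff_gramSchmidtNormed hu hli m) j
  · have hspan : Submodule.span ℂ (Set.range fun m => (e φ m).ofLp) =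
        LinearMap.range (P φ).mulVecLin := by
      refine Submodule.eq_of_le_of_finrank_eq ?_ ?_
      · rw [Submodule.span_le]
        rintro _ ⟨m, rfl⟩
        exact ⟨_, hfix φ m⟩
      · have hlie := (he φ).linearIndependent.map'
          (WithLp.linearEquiv 2 ℂ (Fin N → ℂ)).toLinearMap (LinearEquiv.ker _)
        have hcard := finrank_span_eq_card hlie
        rw [Fintype.card_fin] at hcard
        exact hcard.trans (hrank φ).symm
    have hx : P φ *ᵥ x ∈ Submodule.span ℂ (Set.range fun m => (e φ m).ofLp) := by
      rw [hspan]
      exact ⟨x, rfl⟩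
    obtain ⟨c, hc⟩ := (Submodule.mem_span_range_iff_exists_fun ℂ).1 hx
    have hcoeff : ∀ m, star ((e φ m).ofLp) ⬝ᵥ x = c m := by
      intro m
      have hadj : star ((e φ m).ofLp) ᵥ* P φ = star ((e φ m).ofLp) := by
        conv_rhs => rw [← hfix φ m, star_mulVec, (hherm φ).eq]
      rw [← hadj, ← dotProduct_mulVec, ← hc, dotProduct_sum]
      simp [dotProduct_smul, horth]
    simp only [hcoeff, hc]
end
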